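/- arXiv:2307.08875 — 12 statements merged into one kernel-verified Lean document; each statement's English description precedes it below -/
import Mathlib

section
/- Let S be a finite set, d ≤ |S|, and let Ψ ∈ ℝ^{S×d} be a matrix with linearly independent columns whose first column is the all-ones vector; write ψ(s)ᵀ for the row of Ψ indexed by s and, for w ∈ ℝ^d, write w_{2:d} ∈ ℝ^{d-1} for w with its first coordinate removed. Let p° be a probability vector on S, δ > 0, and let F = { s ↦ ψ(s)ᵀξ : ξ ∈ ℝ^d, ‖ξ‖₂ ≤ 1 }. Define the relaxed IPM uncertainty set P = { q ∈ ℝ^S : Σ_s q(s) = 1 and qᵀf − (p°)ᵀf ≤ δ for all f ∈ F }. Then for every w ∈ ℝ^d, inf_{q ∈ P} qᵀ(Ψw) = (p°)ᵀ(Ψw) − δ‖w_{2:d}‖₂. -/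
open Finset

/-- A linearly independent finite family of vectors in `S → ℝ` can be paired with a single vector
to give arbitrary prescribed values. -/
theorem LinearIndependent.exists_sum_mul_eq {S ι : Type*} [Fintype S] [Fintype ι]
    {v : ι → S → ℝ} (hv : LinearIndependent ℝ v) (u : ι → ℝ) :
    ∃ r : S → ℝ, ∀ j, ∑ s, r s * v j s = u j := by
  classical
  obtain ⟨g, hg⟩ := LinearMap.exists_leftInverse_of_injective (Fintype.linearCombination ℝ v)
    (LinearMap.ker_eq_bot.2 hv.fintypeLinearCombination_injective)
  let f : (S → ℝ) →ₗ[ℝ] ℝ := (Fintype.linearCombination ℝ u) ∘ₗ g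
  refine ⟨fun s => f (Pi.single s 1), fun j => ?_⟩
  have hgv : g (v j) = Pi.single j 1 := by
    simpa using LinearMap.congr_fun hg (Pi.single j 1)
  calc ∑ s, f (Pi.single s 1) * v j s = f (v j) := by
        rw [LinearMap.pi_apply_eq_sum_univ f (v j)]
        refine sum_congr rfl fun s _ => ?_
        rw [smul_eq_mul, mul_comm]
        congr 2
        ext t
        simp [Pi.single_apply, eq_comm]
    _ = u j := by simp [f, hgv]

theorem sum_mul_sum_mul_eq {S ι : Type*} [Fintype S] [Fintype ι] (q : S → ℝ) (Ψ : S → ι → ℝ)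
    (ξ : ι → ℝ) : ∑ s, q s * ∑ j, Ψ s j * ξ j = ∑ j, (∑ s, q s * Ψ s j) * ξ j := by
  simp_rw [mul_sum, sum_mul, ← mul_assoc]
  exact sum_comm

/-- Proposition 1 (IPM uncertainty set): for the IPM defined by the linear
function class `F = {s ↦ ψ(s)ᵀξ : ‖ξ‖₂ ≤ 1}` and the relaxed uncertainty set
`P = {q : ∑ q = 1, d_F(q, p°) ≤ δ}`, we have
`inf_{q ∈ P} qᵀ(Ψw) = (p°)ᵀ(Ψw) − δ‖w_{2:d}‖₂`. -/
theorem stmt0 {S : Type*} [Fintype S] {d : ℕ} (hd : 0 < d)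
    (hdS : d ≤ Fintype.card S)
    (Ψ : S → Fin d → ℝ)
    (hΨ : LinearIndependent ℝ (fun j : Fin d => fun s : S => Ψ s j))
    (hone : ∀ s, Ψ s ⟨0, hd⟩ = 1)
    (p : S → ℝ) (hp0 : ∀ s, 0 ≤ p s) (hp1 : ∑ s, p s = 1)
    (δ : ℝ) (hδ : 0 < δ) (w : Fin d → ℝ) :
    sInf {x : ℝ | ∃ q : S → ℝ, (∑ s, q s) = 1 ∧
        (∀ ξ : Fin d → ℝ, Real.sqrt (∑ j, ξ j ^ 2) ≤ 1 →
          (∑ s, q s * (∑ j, Ψ s j * ξ j)) - (∑ s, p s * (∑ j, Ψ s j * ξ j)) ≤ δ) ∧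
        x = ∑ s, q s * (∑ j, Ψ s j * w j)} =
      (∑ s, p s * (∑ j, Ψ s j * w j)) -
        δ * Real.sqrt (∑ j ∈ Finset.univ.erase (⟨0, hd⟩ : Fin d), w j ^ 2) := by
  set i₀ : Fin d := ⟨0, hd⟩ with hi₀
  set N := Real.sqrt (∑ j ∈ univ.erase i₀, w j ^ 2) with hN
  have hN0 : 0 ≤ N := Real.sqrt_nonneg _
  have hNsq : N ^ 2 = ∑ j ∈ univ.erase i₀, w j ^ 2 :=
    Real.sq_sqrt (sum_nonneg fun j _ => sq_nonneg _)
  let w' : Fin d → ℝ := fun j => if j = i₀ then 0 else w j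
  have sum_w' : ∀ a : Fin d → ℝ, ∑ j, a j * w' j = ∑ j ∈ univ.erase i₀, a j * w j := by
    intro a
    rw [← add_sum_erase _ _ (mem_univ i₀)]
    simp only [w', if_true, mul_zero, zero_add]
    exact sum_congr rfl fun j hj => by rw [if_neg (ne_of_mem_erase hj)]
  have hw'w : ∑ j, w' j * w j = N ^ 2 := by
    simp_rw [mul_comm (w' _)]
    rw [sum_w' w, hNsq]
    exact sum_congr rfl fun j _ => (sq _).symm
  have hw'w' : ∑ j, w' j ^ 2 = N ^ 2 := by
    rw [← hw'w]
    refine sum_congr rfl fun j _ => ?_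
    by_cases h : j = i₀ <;> simp [w', h, sq]
  apply IsLeast.csInf_eq
  constructor
  · obtain ⟨r, hr⟩ := hΨ.exists_sum_mul_eq fun j => -(δ / N) * w' j
    have key : ∀ ξ : Fin d → ℝ, ∑ s, (p s + r s) * ∑ j, Ψ s j * ξ j =
        (∑ s, p s * ∑ j, Ψ s j * ξ j) - δ / N * ∑ j, w' j * ξ j := by
      intro ξ
      simp_rw [add_mul, sum_add_distrib]
      rw [sum_mul_sum_mul_eq r]
      simp_rw [hr, mul_assoc, ← mul_sum]
      ring
    refine ⟨fun s => p s + r s, ?_, fun ξ hξ => ?_, ?_⟩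
    · have h0 := hr i₀
      simp only [hone, w', if_true, mul_zero, mul_one] at h0
      rw [sum_add_distrib, hp1, h0, add_zero]
    · rw [key]
      have hcs := Real.sum_mul_le_sqrt_mul_sqrt univ (fun j => -w' j) ξ
      simp only [neg_sq, neg_mul, sum_neg_distrib, hw'w', Real.sqrt_sq hN0] at hcs
      have h1 : -∑ j, w' j * ξ j ≤ N := hcs.trans (mul_le_of_le_one_right hN0 hξ)
      have h2 := mul_le_mul_of_nonneg_left h1 (div_nonneg hδ.le hN0)
      have h3 : δ / N * N ≤ δ := by
        rcases eq_or_ne N 0 with h | h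
        · simp [h, hδ.le]
        · rw [div_mul_cancel₀ _ h]
      linarith
    · rw [key, hw'w]
      rcases eq_or_ne N 0 with h | h
      · simp [h]
      · field_simp
  · rintro x ⟨q, hq1, hq, rfl⟩
    set u : Fin d → ℝ := fun j => (∑ s, q s * Ψ s j) - ∑ s, p s * Ψ s j with hu
    have hdiff : ∀ ξ : Fin d → ℝ, (∑ s, q s * ∑ j, Ψ s j * ξ j) - (∑ s, p s * ∑ j, Ψ s j * ξ j) =
        ∑ j, u j * ξ j := by
      intro ξ
      simp_rw [sum_mul_sum_mul_eq, hu, sub_mul, sum_sub_distrib]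
    have hu0 : u i₀ = 0 := by simp [hu, hone, hq1, hp1]
    have huw : ∑ j, u j * w j = ∑ j, u j * w' j := by
      refine sum_congr rfl fun j _ => ?_
      by_cases h : j = i₀ <;> simp [w', h, hu0]
    have hscale : ∑ j, u j * (-N⁻¹ * w' j) = -N⁻¹ * ∑ j, u j * w' j := by
      rw [mul_sum]
      exact sum_congr rfl fun j _ => by ring
    have hnorm : Real.sqrt (∑ j, (-N⁻¹ * w' j) ^ 2) ≤ 1 := by
      simp_rw [mul_pow, ← mul_sum, hw'w', neg_sq, ← mul_pow]
      rw [Real.sqrt_sq (mul_nonneg (inv_nonneg.2 hN0) hN0)]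
      exact inv_mul_le_one
    have hbound := hq _ hnorm
    rw [hdiff, hscale] at hbound
    have hd' := hdiff w
    rw [huw] at hd'
    rcases hN0.eq_or_lt with h | h
    · have hz : ∑ j, w' j ^ 2 = 0 := by rw [hw'w', ← h, zero_pow two_ne_zero]
      have hz' : ∀ j, w' j = 0 := fun j =>
        pow_eq_zero_iff two_ne_zero |>.1
          ((sum_eq_zero_iff_of_nonneg fun j _ => sq_nonneg (w' j)).1 hz j (mem_univ j))
      simp only [hz', mul_zero, sum_const_zero] at hd'
      rw [← h]
      linarith
    · have h2 := mul_le_mul_of_nonneg_right hbound h.le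
      have h3 : -N⁻¹ * (∑ j, u j * w' j) * N = -∑ j, u j * w' j := by
        field_simp
      linarith
end

section
/- Let S be a finite set, γ ∈ (0,1), δ > 0, and let Ψ ∈ ℝ^{S×d} have linearly independent columns with first column the all-ones vector; write w_{2:d} for w ∈ ℝ^d with its first coordinate removed. Let P^π ∈ ℝ^{S×S} be a row-stochastic matrix, r^π ∈ [0,1]^S, and let ν be a probability vector on S with ν(s) > 0 for all s and νᵀP^π = νᵀ (stationarity). Let D = diag(ν), Π = Ψ(ΨᵀDΨ)^{-1}ΨᵀD, and define the IPM robust Bellman operator on the linear class by T(Ψw) = r^π + γP^πΨw − γδ‖w_{2:d}‖₂·𝟙, where 𝟙 is the all-ones vector. Let λ_min be the smallest eigenvalue of the symmetric positive-definite matrix ΨᵀDΨ. If γ(1 + δ/√λ_min) < 1, then β := γ(1 + δ/√λ_min) < 1 and ‖ΠT(Ψw) − ΠT(Ψw')‖_ν ≤ β‖Ψw − Ψw'‖_ν for all w, w' ∈ ℝ^d; i.e., the projected robust Bellman operator for the IPM uncertainty set is a β-contraction with respect to ‖·‖_ν. -/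
open Finset Matrix

/-- The seminorm `√(∑ i, ν i * f i ^ 2)` attached to a nonnegative weight `ν`. -/
noncomputable def weightedNorm {ι : Type*} [Fintype ι] (ν f : ι → ℝ) : ℝ :=
  Real.sqrt (∑ i, ν i * f i ^ 2)

section WeightedNorm

variable {ι : Type*} [Fintype ι] {ν : ι → ℝ}

theorem weightedNorm_nonneg (f : ι → ℝ) : 0 ≤ weightedNorm ν f :=
  Real.sqrt_nonneg _

theorem weightedNorm_sq (hν : ∀ i, 0 ≤ ν i) (f : ι → ℝ) :
    weightedNorm ν f ^ 2 = ∑ i, ν i * f i ^ 2 :=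
  Real.sq_sqrt (Finset.sum_nonneg fun i _ => mul_nonneg (hν i) (sq_nonneg _))

theorem weightedNorm_eq_norm (hν : ∀ i, 0 ≤ ν i) (f : ι → ℝ) :
    weightedNorm ν f = ‖(WithLp.toLp 2 (fun i => Real.sqrt (ν i) * f i) :
      EuclideanSpace ℝ ι)‖ := by
  simp [weightedNorm, EuclideanSpace.norm_eq, mul_pow, Real.sq_sqrt (hν _)]

theorem weightedNorm_sub_eq_norm (hν : ∀ i, 0 ≤ ν i) (f g : ι → ℝ) :
    weightedNorm ν (f - g) = ‖(WithLp.toLp 2 (fun i => Real.sqrt (ν i) * f i) :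
      EuclideanSpace ℝ ι) - WithLp.toLp 2 (fun i => Real.sqrt (ν i) * g i)‖ := by
  rw [weightedNorm_eq_norm hν, ← WithLp.toLp_sub]
  congr 2
  ext i
  simp [mul_sub]

theorem weightedNorm_sub_le (hν : ∀ i, 0 ≤ ν i) (f g : ι → ℝ) :
    weightedNorm ν (f - g) ≤ weightedNorm ν f + weightedNorm ν g := by
  rw [weightedNorm_sub_eq_norm hν, weightedNorm_eq_norm hν, weightedNorm_eq_norm hν]
  exact norm_sub_le _ _

theorem abs_weightedNorm_sub_le (hν : ∀ i, 0 ≤ ν i) (f g : ι → ℝ) :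
    |weightedNorm ν f - weightedNorm ν g| ≤ weightedNorm ν (f - g) := by
  rw [weightedNorm_sub_eq_norm hν, weightedNorm_eq_norm hν, weightedNorm_eq_norm hν]
  exact abs_norm_sub_norm_le _ _

theorem weightedNorm_smul (c : ℝ) (f : ι → ℝ) :
    weightedNorm ν (c • f) = |c| * weightedNorm ν f := by
  simp only [weightedNorm, Pi.smul_apply, smul_eq_mul]
  rw [← Real.sqrt_sq_eq_abs, ← Real.sqrt_mul (sq_nonneg c), Finset.mul_sum]
  congr 1
  exact Finset.sum_congr rfl fun i _ => by ring

theorem weightedNorm_const (hν1 : ∑ i, ν i = 1) (c : ℝ) :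
    weightedNorm ν (fun _ => c) = |c| := by
  rw [weightedNorm, ← Finset.sum_mul, hν1, one_mul, Real.sqrt_sq_eq_abs]

/-- A stochastic matrix is nonexpansive for the norm weighted by a stationary distribution. -/
theorem weightedNorm_mulVec_le (hν : ∀ i, 0 ≤ ν i) {P : Matrix ι ι ℝ}
    (hP0 : ∀ i j, 0 ≤ P i j) (hP1 : ∀ i, ∑ j, P i j = 1)
    (hstat : ∀ j, ∑ i, ν i * P i j = ν j) (f : ι → ℝ) :
    weightedNorm ν (P *ᵥ f) ≤ weightedNorm ν f := by
  refine Real.sqrt_le_sqrt ?_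
  have jensen : ∀ i, (P *ᵥ f) i ^ 2 ≤ ∑ j, P i j * f j ^ 2 := fun i => by
    simpa [Matrix.mulVec, dotProduct] using
      (even_two.convexOn_pow (𝕜 := ℝ)).map_sum_le (t := Finset.univ) (w := P i) (p := f)
        (fun j _ => hP0 i j) (hP1 i) (fun _ _ => Set.mem_univ _)
  calc ∑ i, ν i * (P *ᵥ f) i ^ 2
      ≤ ∑ i, ν i * ∑ j, P i j * f j ^ 2 :=
        Finset.sum_le_sum fun i _ => mul_le_mul_of_nonneg_left (jensen i) (hν i)
    _ = ∑ j, (∑ i, ν i * P i j) * f j ^ 2 := by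
        simp only [Finset.mul_sum, Finset.sum_mul, mul_assoc]
        exact Finset.sum_comm
    _ = ∑ j, ν j * f j ^ 2 := by simp only [hstat]

end WeightedNorm

theorem isHermitian_gram {S m : Type*} [Fintype S] [DecidableEq S] {ν : S → ℝ}
    {Ψ : Matrix S m ℝ} : (Ψᵀ * diagonal ν * Ψ).IsHermitian := by
  rw [Matrix.IsHermitian, Matrix.conjTranspose_eq_transpose_of_trivial]
  simp [Matrix.transpose_mul, Matrix.mul_assoc]

section Gram

variable {S m : Type*} [Fintype S] [DecidableEq S] [Fintype m] {ν : S → ℝ} {Ψ : Matrix S m ℝ}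

theorem dotProduct_gram_mulVec (hν : ∀ s, 0 ≤ ν s) (x : m → ℝ) :
    x ⬝ᵥ ((Ψᵀ * diagonal ν * Ψ) *ᵥ x) = weightedNorm ν (Ψ *ᵥ x) ^ 2 := by
  rw [weightedNorm_sq hν, ← Matrix.mulVec_mulVec, ← Matrix.mulVec_mulVec,
    Matrix.dotProduct_mulVec, Matrix.vecMul_transpose]
  simp only [dotProduct, Matrix.mulVec_diagonal]
  exact Finset.sum_congr rfl fun s _ => by ring

theorem posDef_gram (hν : ∀ s, 0 < ν s) (hΨ : LinearIndependent ℝ Ψ.col) :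
    (Ψᵀ * diagonal ν * Ψ).PosDef := by
  have h := (Matrix.PosDef.diagonal hν).conjTranspose_mul_mul_same
    (Matrix.mulVec_injective_iff.mpr hΨ)
  rwa [Matrix.conjTranspose_eq_transpose_of_trivial] at h

/-- The weighted orthogonal projection onto the column span of `Ψ` is nonexpansive. -/
theorem weightedNorm_projection_le [DecidableEq m] (hν : ∀ s, 0 < ν s)
    (hΨ : LinearIndependent ℝ Ψ.col) (f : S → ℝ) :
    weightedNorm ν ((Ψ * (Ψᵀ * diagonal ν * Ψ)⁻¹ * Ψᵀ * diagonal ν) *ᵥ f) ≤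
      weightedNorm ν f := by
  have hν0 : ∀ s, 0 ≤ ν s := fun s => (hν s).le
  have hdet : IsUnit (Ψᵀ * diagonal ν * Ψ).det := (posDef_gram hν hΨ).det_pos.ne'.isUnit
  set u := (Ψᵀ * diagonal ν * Ψ)⁻¹ *ᵥ ((Ψᵀ * diagonal ν) *ᵥ f) with hu
  have hproj : (Ψ * (Ψᵀ * diagonal ν * Ψ)⁻¹ * Ψᵀ * diagonal ν) *ᵥ f = Ψ *ᵥ u := by
    simp only [hu, Matrix.mulVec_mulVec, Matrix.mul_assoc]
  have hnormal : (Ψᵀ * diagonal ν * Ψ) *ᵥ u = (Ψᵀ * diagonal ν) *ᵥ f := by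
    rw [hu, Matrix.mulVec_mulVec, Matrix.mul_nonsing_inv _ hdet, Matrix.one_mulVec]
  have horth : ∑ s, ν s * ((Ψ *ᵥ u) s * f s) = ∑ s, ν s * (Ψ *ᵥ u) s ^ 2 := by
    rw [← weightedNorm_sq hν0, ← dotProduct_gram_mulVec hν0, hnormal, ← Matrix.mulVec_mulVec,
      Matrix.dotProduct_mulVec, Matrix.vecMul_transpose]
    simp only [dotProduct, Matrix.mulVec_diagonal]
    exact Finset.sum_congr rfl fun s _ => by ring
  rw [hproj]
  refine Real.sqrt_le_sqrt ?_
  have hres : 0 ≤ ∑ s, ν s * (f s - (Ψ *ᵥ u) s) ^ 2 :=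
    Finset.sum_nonneg fun s _ => mul_nonneg (hν0 s) (sq_nonneg _)
  have hexpand : ∑ s, ν s * (f s - (Ψ *ᵥ u) s) ^ 2 = ∑ s, ν s * f s ^ 2 -
      2 * ∑ s, ν s * ((Ψ *ᵥ u) s * f s) + ∑ s, ν s * (Ψ *ᵥ u) s ^ 2 := by
    rw [Finset.mul_sum, ← Finset.sum_sub_distrib, ← Finset.sum_add_distrib]
    exact Finset.sum_congr rfl fun s _ => by ring
  linarith

end Gram

/-- A lower bound for the eigenvalues of a real symmetric matrix bounds its quadratic form. -/
theorem mul_dotProduct_self_le_of_eigenvalue_le {m : Type*} [Fintype m] [DecidableEq m]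
    {A : Matrix m m ℝ} (hA : A.IsHermitian) {c : ℝ}
    (hc : c ∈ lowerBounds {μ : ℝ | ∃ x : m → ℝ, x ≠ 0 ∧ A *ᵥ x = μ • x}) (x : m → ℝ) :
    c * (x ⬝ᵥ x) ≤ x ⬝ᵥ (A *ᵥ x) := by
  have hB : (A - c • (1 : Matrix m m ℝ)).IsHermitian := by
    refine hA.sub ?_
    simp [Matrix.IsHermitian]
  have hpos : (A - c • (1 : Matrix m m ℝ)).PosSemidef := by
    rw [hB.posSemidef_iff_eigenvalues_nonneg]
    intro i
    have heig := hB.mulVec_eigenvectorBasis i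
    rw [Matrix.sub_mulVec, Matrix.smul_mulVec, Matrix.one_mulVec, sub_eq_iff_eq_add,
      ← add_smul] at heig
    have hne : (hB.eigenvectorBasis i : m → ℝ) ≠ 0 := fun h =>
      hB.eigenvectorBasis.orthonormal.ne_zero i (by ext j; exact congrFun h j)
    have := hc ⟨_, hne, heig⟩
    simpa using this
  have := hpos.dotProduct_mulVec_nonneg x
  simp only [star_trivial, Matrix.sub_mulVec, Matrix.smul_mulVec, Matrix.one_mulVec,
    dotProduct_sub, dotProduct_smul, smul_eq_mul] at this
  linarith

/-- Lemma 1 (contraction of the projected robust Bellman operator for the IPM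
uncertainty set): if `β := γ(1 + δ/√λ_min) < 1` then `Π T` is a `β`-contraction
w.r.t. the `ν`-weighted norm on the linear class `{Ψw}`. -/
theorem stmt2 {S : Type*} [Fintype S] [DecidableEq S] {d : ℕ} (hd : 0 < d)
    (γ δ : ℝ) (hγ0 : 0 < γ) (hγ1 : γ < 1) (hδ : 0 < δ)
    (Ψ : Matrix S (Fin d) ℝ)
    (hΨ : LinearIndependent ℝ (fun j : Fin d => fun s : S => Ψ s j))
    (hone : ∀ s, Ψ s ⟨0, hd⟩ = 1)
    (P : Matrix S S ℝ) (hP0 : ∀ s s', 0 ≤ P s s') (hP1 : ∀ s, ∑ s', P s s' = 1)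
    (rπ : S → ℝ) (hr : ∀ s, rπ s ∈ Set.Icc (0 : ℝ) 1)
    (ν : S → ℝ) (hν : ∀ s, 0 < ν s) (hν1 : ∑ s, ν s = 1)
    (hstat : ∀ s', ∑ s, ν s * P s s' = ν s')
    (lammin : ℝ)
    (hlam : IsLeast {μ : ℝ | ∃ x : Fin d → ℝ, x ≠ 0 ∧
      (Ψᵀ * Matrix.diagonal ν * Ψ) *ᵥ x = μ • x} lammin)
    (hβ : γ * (1 + δ / Real.sqrt lammin) < 1) :
    let D : Matrix S S ℝ := Matrix.diagonal ν
    let Proj : Matrix S S ℝ := Ψ * (Ψᵀ * D * Ψ)⁻¹ * Ψᵀ * D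
    let T : (Fin d → ℝ) → S → ℝ := fun w s =>
      rπ s + γ * (P *ᵥ (Ψ *ᵥ w)) s -
        γ * δ * Real.sqrt (∑ j ∈ Finset.univ.erase (⟨0, hd⟩ : Fin d), w j ^ 2)
    let β : ℝ := γ * (1 + δ / Real.sqrt lammin)
    β < 1 ∧ ∀ w w' : Fin d → ℝ,
      Real.sqrt (∑ s, ν s * ((Proj *ᵥ T w) s - (Proj *ᵥ T w') s) ^ 2) ≤
        β * Real.sqrt (∑ s, ν s * ((Ψ *ᵥ w) s - (Ψ *ᵥ w') s) ^ 2) := by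

  intro D Proj T β
  refine ⟨hβ, fun w w' => ?_⟩
  have hν0 : ∀ s, 0 ≤ ν s := fun s => (hν s).le
  have hcol : LinearIndependent ℝ Ψ.col := hΨ
  have hlam0 : 0 < lammin := by
    obtain ⟨x, hx, hAx⟩ := hlam.1
    have h := (posDef_gram hν hcol).dotProduct_mulVec_pos hx
    rw [hAx, star_trivial, dotProduct_smul, smul_eq_mul] at h
    exact pos_of_mul_pos_left h (Finset.sum_nonneg fun i _ => mul_self_nonneg (x i))
  let χ : Fin d → ℝ := fun j => if j = ⟨0, hd⟩ then 0 else 1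
  have hχ0 : ∀ j, 0 ≤ χ j := fun j => by simp only [χ]; split_ifs <;> norm_num
  have hχ1 : ∀ j, χ j ≤ 1 := fun j => by simp only [χ]; split_ifs <;> norm_num
  have htail : ∀ v : Fin d → ℝ,
      Real.sqrt (∑ j ∈ Finset.univ.erase (⟨0, hd⟩ : Fin d), v j ^ 2) = weightedNorm χ v := by
    intro v
    rw [weightedNorm, ← Finset.add_sum_erase _ _ (Finset.mem_univ (⟨0, hd⟩ : Fin d))]
    congr 1
    simp only [χ, if_true, zero_mul, zero_add]
    refine Finset.sum_congr rfl fun j hj => ?_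
    rw [if_neg (Finset.ne_of_mem_erase hj), one_mul]
  set g : S → ℝ := Ψ *ᵥ (w - w') with hg
  have hpenalty : |weightedNorm χ w - weightedNorm χ w'| ≤
      weightedNorm ν g / Real.sqrt lammin := by
    refine (abs_weightedNorm_sub_le hχ0 w w').trans ?_
    rw [le_div_iff₀ (Real.sqrt_pos.mpr hlam0)]
    refine (sq_le_sq₀ (mul_nonneg (weightedNorm_nonneg _) (Real.sqrt_nonneg _))
      (weightedNorm_nonneg _)).mp ?_
    rw [mul_pow, Real.sq_sqrt hlam0.le, weightedNorm_sq hχ0, hg, ← dotProduct_gram_mulVec hν0,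
      mul_comm]
    refine le_trans (mul_le_mul_of_nonneg_left ?_ hlam0.le)
      (mul_dotProduct_self_le_of_eigenvalue_le isHermitian_gram hlam.2 (w - w'))
    refine Finset.sum_le_sum fun j _ => ?_
    nlinarith [hχ1 j, mul_self_nonneg ((w - w') j)]
  have hT : T w - T w' =
      γ • (P *ᵥ g) - fun _ => γ * δ * (weightedNorm χ w - weightedNorm χ w') := by
    ext s
    simp only [T, htail, hg, Matrix.mulVec_sub, Pi.sub_apply, Pi.smul_apply, smul_eq_mul]
    ring
  change weightedNorm ν (Proj *ᵥ T w - Proj *ᵥ T w') ≤ β * weightedNorm ν (Ψ *ᵥ w - Ψ *ᵥ w')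
  rw [← Matrix.mulVec_sub, ← Matrix.mulVec_sub, ← hg]
  calc weightedNorm ν (Proj *ᵥ (T w - T w'))
      ≤ weightedNorm ν (T w - T w') := weightedNorm_projection_le hν hcol _
    _ ≤ γ * weightedNorm ν (P *ᵥ g) +
          γ * δ * |weightedNorm χ w - weightedNorm χ w'| := by
        rw [hT]
        refine (weightedNorm_sub_le hν0 _ _).trans_eq ?_
        rw [weightedNorm_smul, weightedNorm_const hν1, abs_mul (γ * δ), abs_of_pos hγ0,
          abs_of_pos (mul_pos hγ0 hδ)]
    _ ≤ γ * weightedNorm ν g + γ * δ * (weightedNorm ν g / Real.sqrt lammin) := by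
        gcongr
        exact weightedNorm_mulVec_le hν0 hP0 hP1 hstat g
    _ = β * weightedNorm ν g := by
        simp only [β]
        ring
end

section
/- Let S be a finite set, γ ∈ (0,1), δ > 0, and Ψ ∈ ℝ^{S×d} with linearly independent columns and first column the all-ones vector; write w_{2:d} for w with its first coordinate removed. Let P^π ∈ ℝ^{S×S} be row-stochastic, r^π ∈ [0,1]^S, and ν a positive probability vector on S with νᵀP^π = νᵀ; let D = diag(ν), and λ_min the smallest eigenvalue of ΨᵀDΨ. Define T(Ψw) = r^π + γP^πΨw − γδ‖w_{2:d}‖₂·𝟙. Then for all w, w' ∈ ℝ^d, ‖T(Ψw) − T(Ψw')‖_ν ≤ γ(1 + δ/√λ_min)·‖Ψw − Ψw'‖_ν. -/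
open Finset Matrix

/-- Jensen's inequality for the square, with finitely supported weights. -/
lemma sq_sum_weighted_le {S : Type*} [Fintype S] (p : S → ℝ) (hp : ∀ s, 0 ≤ p s)
    (hp1 : ∑ s, p s = 1) (f : S → ℝ) : (∑ s, p s * f s) ^ 2 ≤ ∑ s, p s * f s ^ 2 :=
  Real.pow_arith_mean_le_arith_mean_pow_of_even Finset.univ p f (fun s _ => hp s) hp1 even_two

/-- The triangle inequality for the `ℓ²` norm on a finite set. -/
lemma sqrt_sum_sq_add_le {ι : Type*} (t : Finset ι) (a b : ι → ℝ) :
    Real.sqrt (∑ i ∈ t, (a i + b i) ^ 2) ≤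
      Real.sqrt (∑ i ∈ t, a i ^ 2) + Real.sqrt (∑ i ∈ t, b i ^ 2) := by
  have hcs := Real.sum_mul_le_sqrt_mul_sqrt t a b
  have ha := Real.sq_sqrt (Finset.sum_nonneg fun i (_ : i ∈ t) => sq_nonneg (a i))
  have hb := Real.sq_sqrt (Finset.sum_nonneg fun i (_ : i ∈ t) => sq_nonneg (b i))
  refine Real.sqrt_le_iff.2 ⟨by positivity, ?_⟩
  have hexp : ∑ i ∈ t, (a i + b i) ^ 2 =
      ∑ i ∈ t, a i ^ 2 + 2 * ∑ i ∈ t, a i * b i + ∑ i ∈ t, b i ^ 2 := by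
    rw [Finset.mul_sum, ← Finset.sum_add_distrib, ← Finset.sum_add_distrib]
    exact Finset.sum_congr rfl fun i _ => by ring
  rw [hexp]
  nlinarith

/-- The reverse triangle inequality for the `ℓ²` norm on a finite set. -/
lemma abs_sqrt_sum_sq_sub_le {ι : Type*} (t : Finset ι) (a b : ι → ℝ) :
    |Real.sqrt (∑ i ∈ t, a i ^ 2) - Real.sqrt (∑ i ∈ t, b i ^ 2)| ≤
      Real.sqrt (∑ i ∈ t, (a i - b i) ^ 2) := by
  have h1 := sqrt_sum_sq_add_le t (fun i => a i - b i) b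
  have h2 := sqrt_sum_sq_add_le t (fun i => b i - a i) a
  simp only [sub_add_cancel] at h1 h2
  have h3 : ∑ i ∈ t, (b i - a i) ^ 2 = ∑ i ∈ t, (a i - b i) ^ 2 :=
    Finset.sum_congr rfl fun i _ => by ring
  rw [h3] at h2
  exact abs_sub_le_iff.2 ⟨by linarith, by linarith⟩

/-- A stochastic matrix is nonexpansive in the norm weighted by a stationary distribution. -/
lemma sum_weighted_sq_mulVec_le {S : Type*} [Fintype S] (P : Matrix S S ℝ)
    (hP0 : ∀ s s', 0 ≤ P s s') (hP1 : ∀ s, ∑ s', P s s' = 1)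
    (ν : S → ℝ) (hν : ∀ s, 0 ≤ ν s) (hstat : ∀ s', ∑ s, ν s * P s s' = ν s') (V : S → ℝ) :
    ∑ s, ν s * (P *ᵥ V) s ^ 2 ≤ ∑ s, ν s * V s ^ 2 := by
  calc ∑ s, ν s * (P *ᵥ V) s ^ 2 ≤ ∑ s, ν s * ∑ s', P s s' * V s' ^ 2 :=
        Finset.sum_le_sum fun s _ => mul_le_mul_of_nonneg_left
          (sq_sum_weighted_le (P s) (hP0 s) (hP1 s) V) (hν s)
    _ = ∑ s', (∑ s, ν s * P s s') * V s' ^ 2 := by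
        simp only [Finset.mul_sum, Finset.sum_mul, mul_assoc]
        exact Finset.sum_comm
    _ = ∑ s, ν s * V s ^ 2 := by simp only [hstat]

/-- Subtracting a constant changes a weighted norm by at most its absolute value. -/
lemma sqrt_sum_weighted_sq_sub_const_le {S : Type*} [Fintype S] (ν : S → ℝ)
    (hν : ∀ s, 0 ≤ ν s) (hν1 : ∑ s, ν s = 1) (f : S → ℝ) (c : ℝ) :
    Real.sqrt (∑ s, ν s * (f s - c) ^ 2) ≤ Real.sqrt (∑ s, ν s * f s ^ 2) + |c| := by
  have h := sqrt_sum_sq_add_le Finset.univ (fun s => Real.sqrt (ν s) * f s)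
    (fun s => Real.sqrt (ν s) * (-c))
  simp only [← mul_add, mul_pow, Real.sq_sqrt (hν _)] at h
  rw [← Finset.sum_mul, hν1, one_mul, neg_sq, Real.sqrt_sq_eq_abs] at h
  simpa only [sub_eq_add_neg] using h

/-- The quadratic form of a weighted Gram matrix is the squared weighted norm. -/
lemma dotProduct_weighted_gram_mulVec {S n : Type*} [Fintype S] [DecidableEq S] [Fintype n]
    (Ψ : Matrix S n ℝ) (ν : S → ℝ) (x : n → ℝ) :
    x ⬝ᵥ ((Ψᵀ * Matrix.diagonal ν * Ψ) *ᵥ x) = ∑ s, ν s * (Ψ *ᵥ x) s ^ 2 := by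
  rw [← Matrix.mulVec_mulVec, ← Matrix.mulVec_mulVec, Matrix.dotProduct_mulVec,
    Matrix.vecMul_transpose]
  simp only [dotProduct, Matrix.mulVec_diagonal]
  exact Finset.sum_congr rfl fun s _ => by ring

/-- A lower bound on the eigenvalues of a real symmetric matrix bounds its quadratic form. -/
lemma mul_dotProduct_self_le_of_eigenvalue_lowerBound {n : Type*} [Fintype n] [DecidableEq n]
    (A : Matrix n n ℝ) (hA : A.IsHermitian) (l : ℝ)
    (hl : ∀ (μ : ℝ) (x : n → ℝ), x ≠ 0 → A *ᵥ x = μ • x → l ≤ μ) (x : n → ℝ) :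
    l * (x ⬝ᵥ x) ≤ x ⬝ᵥ (A *ᵥ x) := by
  have hB : (A - l • (1 : Matrix n n ℝ)).IsHermitian :=
    hA.sub (by simp [Matrix.IsHermitian])
  have hpos : (A - l • (1 : Matrix n n ℝ)).PosSemidef := by
    refine hB.posSemidef_iff_eigenvalues_nonneg.2 fun i => ?_
    have hev := hB.mulVec_eigenvectorBasis i
    rw [Matrix.sub_mulVec, Matrix.smul_mulVec, Matrix.one_mulVec, sub_eq_iff_eq_add,
      ← add_smul] at hev
    have h := hl _ _ (fun h0 => hB.eigenvectorBasis.orthonormal.ne_zero i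
      (PiLp.ext fun j => congrFun h0 j)) hev
    simpa using h
  have h := hpos.dotProduct_mulVec_nonneg x
  simp only [star_trivial, Matrix.sub_mulVec, Matrix.smul_mulVec, Matrix.one_mulVec,
    dotProduct_sub, dotProduct_smul, smul_eq_mul] at h
  linarith

/-- Lipschitz bound for the (unprojected) IPM robust Bellman operator on the
linear class: `‖T(Ψw) − T(Ψw')‖_ν ≤ γ(1 + δ/√λ_min)‖Ψw − Ψw'‖_ν`. -/
theorem stmt3 {S : Type*} [Fintype S] [DecidableEq S] {d : ℕ} (hd : 0 < d)
    (γ δ : ℝ) (hγ0 : 0 < γ) (hγ1 : γ < 1) (hδ : 0 < δ)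
    (Ψ : Matrix S (Fin d) ℝ)
    (hΨ : LinearIndependent ℝ (fun j : Fin d => fun s : S => Ψ s j))
    (hone : ∀ s, Ψ s ⟨0, hd⟩ = 1)
    (P : Matrix S S ℝ) (hP0 : ∀ s s', 0 ≤ P s s') (hP1 : ∀ s, ∑ s', P s s' = 1)
    (rπ : S → ℝ) (hr : ∀ s, rπ s ∈ Set.Icc (0 : ℝ) 1)
    (ν : S → ℝ) (hν : ∀ s, 0 < ν s) (hν1 : ∑ s, ν s = 1)
    (hstat : ∀ s', ∑ s, ν s * P s s' = ν s')
    (lammin : ℝ)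
    (hlam : IsLeast {μ : ℝ | ∃ x : Fin d → ℝ, x ≠ 0 ∧
      (Ψᵀ * Matrix.diagonal ν * Ψ) *ᵥ x = μ • x} lammin) :
    let T : (Fin d → ℝ) → S → ℝ := fun w s =>
      rπ s + γ * (P *ᵥ (Ψ *ᵥ w)) s -
        γ * δ * Real.sqrt (∑ j ∈ Finset.univ.erase (⟨0, hd⟩ : Fin d), w j ^ 2)
    ∀ w w' : Fin d → ℝ,
      Real.sqrt (∑ s, ν s * (T w s - T w' s) ^ 2) ≤
        γ * (1 + δ / Real.sqrt lammin) *
          Real.sqrt (∑ s, ν s * ((Ψ *ᵥ w) s - (Ψ *ᵥ w') s) ^ 2) := by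
  intro T w w'
  set x : Fin d → ℝ := w - w' with hx
  set e : Fin d := ⟨0, hd⟩
  set A := Ψᵀ * Matrix.diagonal ν * Ψ with hAdef
  have hA : A.IsHermitian := by
    simp [Matrix.IsHermitian, hAdef, Matrix.conjTranspose_eq_transpose_of_trivial,
      Matrix.transpose_mul, Matrix.mul_assoc]
  have hray := mul_dotProduct_self_le_of_eigenvalue_lowerBound A hA lammin
    (fun μ y hy hev => hlam.2 ⟨y, hy, hev⟩) x
  rw [dotProduct_weighted_gram_mulVec] at hray
  have hlampos : 0 < lammin := by
    obtain ⟨y, hy, hev⟩ := hlam.1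
    have hq := dotProduct_weighted_gram_mulVec Ψ ν y
    rw [hev, dotProduct_smul, smul_eq_mul] at hq
    have hne : Ψ *ᵥ y ≠ 0 := fun h0 =>
      hy (Matrix.mulVec_injective_iff.2 hΨ (h0.trans (Matrix.mulVec_zero Ψ).symm))
    obtain ⟨s, hs⟩ := Function.ne_iff.1 hne
    have hpos : 0 < ∑ s, ν s * (Ψ *ᵥ y) s ^ 2 :=
      Finset.sum_pos' (fun s _ => mul_nonneg (hν s).le (sq_nonneg _))
        ⟨s, Finset.mem_univ s, mul_pos (hν s) (sq_pos_iff.2 hs)⟩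
    rw [← hq] at hpos
    refine pos_of_mul_pos_left hpos ?_
    exact Finset.sum_nonneg fun i _ => mul_self_nonneg (y i)
  set N := Real.sqrt (∑ s, ν s * (Ψ *ᵥ x) s ^ 2) with hN
  have hNeq : Real.sqrt (∑ s, ν s * ((Ψ *ᵥ w) s - (Ψ *ᵥ w') s) ^ 2) = N := by
    simp only [hN, hx, Matrix.mulVec_sub, Pi.sub_apply]
  set c := Real.sqrt (∑ j ∈ Finset.univ.erase e, w j ^ 2) -
    Real.sqrt (∑ j ∈ Finset.univ.erase e, w' j ^ 2) with hc
  have hcN : |c| ≤ N / Real.sqrt lammin := by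
    refine (abs_sqrt_sum_sq_sub_le _ w w').trans ?_
    rw [hN, ← Real.sqrt_div' _ hlampos.le]
    refine Real.sqrt_le_sqrt ?_
    rw [le_div_iff₀ hlampos, mul_comm]
    refine le_trans (mul_le_mul_of_nonneg_left ?_ hlampos.le) hray
    calc ∑ j ∈ Finset.univ.erase e, (w j - w' j) ^ 2 ≤ ∑ j, (w j - w' j) ^ 2 :=
          Finset.sum_le_sum_of_subset_of_nonneg (Finset.erase_subset _ _)
            fun j _ _ => sq_nonneg _
      _ = x ⬝ᵥ x := by simp [dotProduct, hx, sq]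
  have hT : ∀ s, T w s - T w' s = γ * ((P *ᵥ (Ψ *ᵥ x)) s - δ * c) := fun s => by
    simp only [T, hc, hx, Matrix.mulVec_sub, Pi.sub_apply]
    ring
  have hfac : ∑ s, ν s * (T w s - T w' s) ^ 2 =
      γ ^ 2 * ∑ s, ν s * ((P *ᵥ (Ψ *ᵥ x)) s - δ * c) ^ 2 := by
    rw [Finset.mul_sum]
    exact Finset.sum_congr rfl fun s _ => by rw [hT]; ring
  rw [hNeq, hfac, Real.sqrt_mul (sq_nonneg γ), Real.sqrt_sq hγ0.le, mul_assoc]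
  refine mul_le_mul_of_nonneg_left ?_ hγ0.le
  calc _ ≤ Real.sqrt (∑ s, ν s * (P *ᵥ (Ψ *ᵥ x)) s ^ 2) + |δ * c| :=
        sqrt_sum_weighted_sq_sub_const_le ν (fun s => (hν s).le) hν1 _ _
    _ ≤ N + δ * (N / Real.sqrt lammin) := by
        rw [abs_mul, abs_of_pos hδ]
        exact add_le_add (Real.sqrt_le_sqrt (sum_weighted_sq_mulVec_le P hP0 hP1 ν
          (fun s => (hν s).le) hstat _)) (mul_le_mul_of_nonneg_left hcN hδ.le)
    _ = (1 + δ / Real.sqrt lammin) * N := by ring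
end

section
/- Let f: [0,∞) → ℝ be continuous and strictly convex with f(1) = 0, let γ ∈ (0,1), δ > 0, and let S be a finite set with |S| = n ≥ 2. Then there exist probability vectors p° and q on S with all entries of p° strictly positive, such that the f-divergence d_f(q, p°) := Σ_s p°(s)·f(q(s)/p°(s)) satisfies d_f(q, p°) ≤ δ, and there exists s₀ ∈ S with q(s₀) = p°(s₀)/γ. In particular, for every β ∈ (0,1) one has γ·q(s₀) > β·p°(s₀), so the f-divergence ball of radius δ around p° violates the assumption that γ·q ≤ β·p° pointwise for some β < 1. -/
open Finset

theorem sum_ite_eq_add_card_sub_one_mul {S : Type*} [Fintype S] [DecidableEq S] (s₀ : S)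
    (a b : ℝ) :
    ∑ s, (if s = s₀ then a else b) = a + ((Fintype.card S : ℝ) - 1) * b := by
  have h (s : S) : (if s = s₀ then a else b) = b + if s = s₀ then a - b else 0 := by
    split_ifs <;> ring
  simp only [h, Finset.sum_add_distrib, Finset.sum_ite_eq', Finset.mem_univ, if_true,
    Finset.sum_const, Finset.card_univ, nsmul_eq_mul]
  ring

theorem exists_two_point_divergence_lt {f : ℝ → ℝ} (hf : ContinuousAt f 1) (hf1 : f 1 = 0)
    {γ δ : ℝ} (hγ0 : 0 < γ) (hδ : 0 < δ) :
    ∃ ε : ℝ, 0 < ε ∧ ε < γ ∧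
      ε * f (1 / γ) + (1 - ε) * f ((1 - ε / γ) / (1 - ε)) < δ := by
  have hr : ContinuousAt (fun ε : ℝ => (1 - ε / γ) / (1 - ε)) 0 :=
    ContinuousAt.div (by fun_prop) (by fun_prop) (by norm_num)
  have hfr : ContinuousAt (fun ε : ℝ => f ((1 - ε / γ) / (1 - ε))) 0 :=
    ContinuousAt.comp (f := fun ε : ℝ => (1 - ε / γ) / (1 - ε)) (by simpa using hf) hr
  have hF : ContinuousAt
      (fun ε : ℝ => ε * f (1 / γ) + (1 - ε) * f ((1 - ε / γ) / (1 - ε))) 0 := by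
    exact (continuousAt_id.mul continuousAt_const).add
      ((continuousAt_const.sub continuousAt_id).mul hfr)
  have hlt := hF.eventually_lt (continuousAt_const (y := δ)) (by simpa [hf1] using hδ)
  obtain ⟨ε, ⟨h, hεγ⟩, hε⟩ := (((hlt.and (eventually_lt_nhds hγ0)).filter_mono
    nhdsWithin_le_nhds).and (self_mem_nhdsWithin (s := Set.Ioi (0 : ℝ)))).exists
  exact ⟨ε, hε, hεγ, h⟩

/-- Proposition 3: for any `f`-divergence and radius `δ > 0` there are
probability vectors `p°` (positive) and `q` with `d_f(q,p°) ≤ δ` and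
`q(s₀) = p°(s₀)/γ` at some state `s₀`; hence `γ q(s₀) > β p°(s₀)` for any
`β ∈ (0,1)`, so the coverage assumption fails. -/
theorem stmt5 {S : Type*} [Fintype S] (hS : 2 ≤ Fintype.card S)
    (f : ℝ → ℝ) (hfc : ContinuousOn f (Set.Ici (0 : ℝ)))
    (hfconv : StrictConvexOn ℝ (Set.Ici (0 : ℝ)) f) (hf1 : f 1 = 0)
    (γ δ : ℝ) (hγ0 : 0 < γ) (hγ1 : γ < 1) (hδ : 0 < δ) :
    ∃ p q : S → ℝ,
      (∀ s, 0 < p s) ∧ (∑ s, p s) = 1 ∧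
      (∀ s, 0 ≤ q s) ∧ (∑ s, q s) = 1 ∧
      (∑ s, p s * f (q s / p s)) ≤ δ ∧
      ∃ s₀ : S, q s₀ = p s₀ / γ ∧
        ∀ β : ℝ, 0 < β → β < 1 → β * p s₀ < γ * q s₀ := by
  classical
  obtain ⟨ε, hε, hεγ, hdiv⟩ := exists_two_point_divergence_lt
    (hfc.continuousAt (Ici_mem_nhds zero_lt_one)) hf1 hγ0 hδ
  obtain ⟨s₀⟩ : Nonempty S := Fintype.card_pos_iff.mp (by omega)
  have hm : 0 < (Fintype.card S : ℝ) - 1 := by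
    have : (2 : ℝ) ≤ Fintype.card S := by exact_mod_cast hS
    linarith
  set m : ℝ := (Fintype.card S : ℝ) - 1 with hm_def
  have hε1 : 0 < 1 - ε := by linarith
  have hεγ1 : 0 ≤ 1 - ε / γ := sub_nonneg.mpr ((div_le_one hγ0).mpr hεγ.le)
  refine ⟨fun s => if s = s₀ then ε else (1 - ε) / m,
    fun s => if s = s₀ then ε / γ else (1 - ε / γ) / m, ?_, ?_, ?_, ?_, ?_, s₀, ?_, ?_⟩
  · intro s
    dsimp only
    split_ifs <;> positivity
  · rw [sum_ite_eq_add_card_sub_one_mul, ← hm_def]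
    field_simp
    ring
  · intro s
    dsimp only
    split_ifs <;> positivity
  · rw [sum_ite_eq_add_card_sub_one_mul, ← hm_def]
    field_simp
    ring
  · have hterm (s : S) : (if s = s₀ then ε else (1 - ε) / m) *
        f ((if s = s₀ then ε / γ else (1 - ε / γ) / m) / (if s = s₀ then ε else (1 - ε) / m)) =
        if s = s₀ then ε * f (1 / γ) else (1 - ε) / m * f ((1 - ε / γ) / (1 - ε)) := by
      split_ifs
      · rw [div_right_comm, div_self hε.ne']
      · rw [div_div_div_cancel_right₀ hm.ne']
    simp only [hterm]
    rw [sum_ite_eq_add_card_sub_one_mul, ← hm_def, ← mul_assoc, mul_div_cancel₀ _ hm.ne']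
    exact hdiv.le
  · simp
  · intro β _ hβ1
    simp only [if_true]
    rw [mul_div_cancel₀ _ hγ0.ne']
    nlinarith
end

section
/- Let m ≥ 1, let Δ_m be the probability simplex in ℝ^m, and let Unif_m = (1/m,…,1/m). Let d: Δ_m × Δ_m → [0,∞) satisfy d(Unif_m, Unif_m) = 0 and be C-continuous at Unif_m for some C > 0, meaning that for every ε > 0, {α ∈ Δ_m : d(α, Unif_m) ≤ ε} ⊆ {α ∈ Δ_m : ‖α − Unif_m‖_∞ ≤ Cε}. Let γ ∈ (0,1) and 0 < δ < (1−γ)/(γmC). Then β := γ(1 + mCδ) < 1, and for every finite set S, every probability vector p on S, and every s' ∈ S, γ · Σ_{(s₁,…,s_m) ∈ S^m} (∏_{i=1}^m p(s_i)) · sup{ Σ_{i=1}^m α_i·𝟙[s_i = s'] : α ∈ Δ_m, d(α, Unif_m) ≤ δ } ≤ β·p(s'). -/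
open Finset

/-- Under i.i.d. sampling from `p`, the `i`-th draw has distribution `p`. -/
theorem sum_prod_mul_apply_eq {ι S R : Type*} [Fintype ι] [DecidableEq ι] [Fintype S]
    [CommSemiring R] (p : S → R) (hp : ∑ s, p s = 1) (g : S → R) (i : ι) :
    ∑ v : ι → S, (∏ j, p (v j)) * g (v i) = ∑ s, p s * g s := by
  have h := Fintype.prod_sum fun (j : ι) (s : S) => p s * if j = i then g s else 1
  have hl : ∏ j, ∑ s, p s * (if j = i then g s else 1) = ∑ s, p s * g s := by
    rw [Finset.prod_eq_single i]
    · simp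
    · intro j _ hj
      simp [hj, hp]
    · simp
  rw [hl] at h
  rw [h]
  refine Finset.sum_congr rfl fun v _ => ?_
  rw [Finset.prod_mul_distrib, Fintype.prod_ite_eq']

/-- Proposition 2 (DS uncertainty set with small radius satisfies the coverage
assumption): if the divergence `dm` is `C`-continuous at the uniform
distribution and `δ < (1−γ)/(γmC)`, then `β := γ(1 + mCδ) < 1` and the expected
worst-case probability the perturbed sampling distribution assigns to any
state `s'` is at most `β p(s')/γ`. -/
theorem stmt6 {m : ℕ} (hm : 1 ≤ m) (C : ℝ) (hC : 0 < C)
    (dm : (Fin m → ℝ) → (Fin m → ℝ) → ℝ)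
    (hdm0 : ∀ α β' : Fin m → ℝ,
      ((∀ i, 0 ≤ α i) ∧ ∑ i, α i = 1) → ((∀ i, 0 ≤ β' i) ∧ ∑ i, β' i = 1) →
      0 ≤ dm α β')
    (hduu : dm (fun _ => (1 : ℝ) / m) (fun _ => (1 : ℝ) / m) = 0)
    (hcont : ∀ ε : ℝ, 0 < ε → ∀ α : Fin m → ℝ, (∀ i, 0 ≤ α i) → (∑ i, α i = 1) →
      dm α (fun _ => (1 : ℝ) / m) ≤ ε → ∀ i, |α i - 1 / m| ≤ C * ε)
    (γ δ : ℝ) (hγ0 : 0 < γ) (hγ1 : γ < 1) (hδ0 : 0 < δ)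
    (hδ : δ < (1 - γ) / (γ * m * C))
    {S : Type*} [Fintype S] [DecidableEq S]
    (p : S → ℝ) (hp0 : ∀ s, 0 ≤ p s) (hp1 : ∑ s, p s = 1) (s' : S) :
    γ * (1 + m * C * δ) < 1 ∧
    γ * ∑ v : Fin m → S, (∏ i, p (v i)) *
        sSup {x : ℝ | ∃ α : Fin m → ℝ, (∀ i, 0 ≤ α i) ∧ (∑ i, α i = 1) ∧
          dm α (fun _ => (1 : ℝ) / m) ≤ δ ∧
          x = ∑ i, α i * (if v i = s' then (1 : ℝ) else 0)} ≤
      γ * (1 + m * C * δ) * p s' := by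
  have hm0 : (0 : ℝ) < m := by exact_mod_cast hm
  constructor
  · rw [lt_div_iff₀ (by positivity)] at hδ
    linarith
  have hsup : ∀ v : Fin m → S,
      sSup {x : ℝ | ∃ α : Fin m → ℝ, (∀ i, 0 ≤ α i) ∧ (∑ i, α i = 1) ∧
          dm α (fun _ => (1 : ℝ) / m) ≤ δ ∧
          x = ∑ i, α i * (if v i = s' then (1 : ℝ) else 0)} ≤
        ∑ i, (1 / m + C * δ) * (if v i = s' then (1 : ℝ) else 0) := by
    intro v
    refine Real.sSup_le ?_ (Finset.sum_nonneg fun i _ => by positivity)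
    rintro x ⟨α, hα0, hα1, hαδ, rfl⟩
    refine Finset.sum_le_sum fun i _ => mul_le_mul_of_nonneg_right ?_ (by positivity)
    linarith [le_of_abs_le (hcont δ hδ0 α hα0 hα1 hαδ i)]
  rw [mul_assoc γ (1 + m * C * δ)]
  refine mul_le_mul_of_nonneg_left ?_ hγ0.le
  refine (Finset.sum_le_sum fun v _ => mul_le_mul_of_nonneg_left (hsup v)
    (Finset.prod_nonneg fun i _ => hp0 (v i))).trans_eq ?_
  have hmarg : ∀ i : Fin m,
      ∑ v : Fin m → S, (∏ j, p (v j)) * (if v i = s' then (1 : ℝ) else 0) = p s' := by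
    intro i
    rw [sum_prod_mul_apply_eq p hp1 (fun s => if s = s' then (1 : ℝ) else 0) i]
    simp
  simp_rw [Finset.mul_sum, mul_left_comm _ (1 / (m : ℝ) + C * δ)]
  rw [Finset.sum_comm]
  simp_rw [← Finset.mul_sum, hmarg]
  rw [Finset.sum_const, Finset.card_univ, Fintype.card_fin, nsmul_eq_mul]
  field_simp
end

section
/- Let π and π' be policies, and let κ = κ_π and κ' = κ_{π'} be worst-case kernels for π and π' respectively. Then for every probability vector ρ on S: (1/(1−γ))·Σ_s d_ρ^{π',κ'}(s)·Σ_a π'(a|s)·A^π(s,a) ≤ V^{π'}(ρ) − V^π(ρ) ≤ (1/(1−γ))·Σ_s d_ρ^{π',κ}(s)·Σ_a π'(a|s)·A^π(s,a). -/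
open Finset Matrix

/-- Powers of the transpose of a row-stochastic matrix preserve the probability simplex. -/
lemma transpose_pow_mulVec_mem_simplex {S : Type*} [Fintype S] [DecidableEq S]
    {M : Matrix S S ℝ} (hM0 : ∀ s s', 0 ≤ M s s') (hM1 : ∀ s, ∑ s', M s s' = 1)
    {ρ : S → ℝ} (hρ0 : ∀ s, 0 ≤ ρ s) (hρ1 : ∑ s, ρ s = 1) (t : ℕ) :
    (∀ s, 0 ≤ ((Mᵀ ^ t) *ᵥ ρ) s) ∧ ∑ s, ((Mᵀ ^ t) *ᵥ ρ) s = 1 := by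
  induction t with
  | zero => simpa using ⟨hρ0, hρ1⟩
  | succ t ih =>
    rw [pow_succ', ← Matrix.mulVec_mulVec]
    generalize (Mᵀ ^ t) *ᵥ ρ = x at ih
    refine ⟨fun s => Finset.sum_nonneg fun s' _ => mul_nonneg (hM0 s' s) (ih.1 s'), ?_⟩
    simp only [Matrix.mulVec, dotProduct, Matrix.transpose_apply]
    rw [Finset.sum_comm]
    simp_rw [← Finset.sum_mul, hM1, one_mul]
    exact ih.2

/-- The unnormalized discounted visitation measure of a row-stochastic matrix. -/
noncomputable def discountedOccupancy {S : Type*} [Fintype S] [DecidableEq S]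
    (γ : ℝ) (M : Matrix S S ℝ) (ρ : S → ℝ) (s : S) : ℝ :=
  ∑' t : ℕ, γ ^ t * ((Mᵀ ^ t) *ᵥ ρ) s

section Occupancy

variable {S : Type*} [Fintype S] [DecidableEq S] {γ : ℝ} {M : Matrix S S ℝ} {ρ : S → ℝ}

lemma discountedOccupancy_nonneg (hγ0 : 0 ≤ γ)
    (hM0 : ∀ s s', 0 ≤ M s s') (hM1 : ∀ s, ∑ s', M s s' = 1)
    (hρ0 : ∀ s, 0 ≤ ρ s) (hρ1 : ∑ s, ρ s = 1) (s : S) : 0 ≤ discountedOccupancy γ M ρ s :=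
  tsum_nonneg fun t => mul_nonneg (pow_nonneg hγ0 t)
    ((transpose_pow_mulVec_mem_simplex hM0 hM1 hρ0 hρ1 t).1 s)

lemma summable_discountedOccupancy (hγ0 : 0 ≤ γ) (hγ1 : γ < 1)
    (hM0 : ∀ s s', 0 ≤ M s s') (hM1 : ∀ s, ∑ s', M s s' = 1)
    (hρ0 : ∀ s, 0 ≤ ρ s) (hρ1 : ∑ s, ρ s = 1) (s : S) :
    Summable fun t : ℕ => γ ^ t * ((Mᵀ ^ t) *ᵥ ρ) s := by
  have hx := transpose_pow_mulVec_mem_simplex hM0 hM1 hρ0 hρ1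
  refine Summable.of_nonneg_of_le (fun t => mul_nonneg (pow_nonneg hγ0 t) ((hx t).1 s))
    (fun t => mul_le_of_le_one_right (pow_nonneg hγ0 t) ?_) (summable_geometric_of_lt_one hγ0 hγ1)
  rw [← (hx t).2]
  exact Finset.single_le_sum (fun s' _ => (hx t).1 s') (Finset.mem_univ s)

/-- The flow (Bellman balance) equation of the discounted visitation measure. -/
lemma discountedOccupancy_eq (hγ0 : 0 ≤ γ) (hγ1 : γ < 1)
    (hM0 : ∀ s s', 0 ≤ M s s') (hM1 : ∀ s, ∑ s', M s s' = 1)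
    (hρ0 : ∀ s, 0 ≤ ρ s) (hρ1 : ∑ s, ρ s = 1) (s : S) :
    discountedOccupancy γ M ρ s = ρ s + γ * ∑ s', M s' s * discountedOccupancy γ M ρ s' := by
  have hsum := summable_discountedOccupancy hγ0 hγ1 hM0 hM1 hρ0 hρ1
  have hterm (t : ℕ) : γ ^ (t + 1) * ((Mᵀ ^ (t + 1)) *ᵥ ρ) s =
      γ * ∑ s', M s' s * (γ ^ t * ((Mᵀ ^ t) *ᵥ ρ) s') := by
    rw [pow_succ' Mᵀ, ← Matrix.mulVec_mulVec]
    generalize (Mᵀ ^ t) *ᵥ ρ = x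
    simp only [Matrix.mulVec, dotProduct, Matrix.transpose_apply, Finset.mul_sum]
    exact Finset.sum_congr rfl fun s' _ => by ring
  simp only [discountedOccupancy]
  rw [(hsum s).tsum_eq_zero_add]
  simp_rw [hterm]
  rw [tsum_mul_left, Summable.tsum_finsetSum fun s' _ => (hsum s').mul_left _]
  simp [tsum_mul_left]

lemma sum_discountedOccupancy_mul (hγ0 : 0 ≤ γ) (hγ1 : γ < 1)
    (hM0 : ∀ s s', 0 ≤ M s s') (hM1 : ∀ s, ∑ s', M s s' = 1)
    (hρ0 : ∀ s, 0 ≤ ρ s) (hρ1 : ∑ s, ρ s = 1) (w : S → ℝ) :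
    ∑ s, discountedOccupancy γ M ρ s * (w s - γ * ∑ s', M s s' * w s') = ∑ s, ρ s * w s := by
  have key : ∑ s, discountedOccupancy γ M ρ s * w s =
      ∑ s, ρ s * w s + ∑ s, discountedOccupancy γ M ρ s * (γ * ∑ s', M s s' * w s') := by
    calc ∑ s, discountedOccupancy γ M ρ s * w s
        = ∑ s, (ρ s + γ * ∑ s', M s' s * discountedOccupancy γ M ρ s') * w s :=
          Finset.sum_congr rfl fun s _ => by
            rw [← discountedOccupancy_eq hγ0 hγ1 hM0 hM1 hρ0 hρ1 s]
      _ = _ := by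
        simp only [add_mul, Finset.sum_add_distrib, Finset.mul_sum, Finset.sum_mul]
        congr 1
        rw [Finset.sum_comm]
        exact Finset.sum_congr rfl fun s _ => Finset.sum_congr rfl fun s' _ => by ring
  simp only [mul_sub, Finset.sum_sub_distrib]
  linarith

end Occupancy

/-- A minimum over a compact set of linear functionals is a lower bound. -/
lemma sInf_linear_le {S : Type*} [Fintype S] {P : Set (S → ℝ)} (hP : IsCompact P)
    {p : S → ℝ} (hp : p ∈ P) (v : S → ℝ) :
    sInf {x : ℝ | ∃ p ∈ P, x = ∑ s, p s * v s} ≤ ∑ s, p s * v s := by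
  refine csInf_le ?_ ⟨p, hp, rfl⟩
  have hc : Continuous fun p : S → ℝ => ∑ s, p s * v s := by fun_prop
  refine (hP.image hc).bddBelow.mono ?_
  rintro x ⟨q, hq, rfl⟩
  exact ⟨q, hq, rfl⟩

/-- Robust performance difference lemma: for worst-case kernels `κ = κ_π` and
`κ' = κ_{π'}`,
`(1/(1−γ)) Σ_s d_ρ^{π',κ'}(s) Σ_a π'(a|s) A^π(s,a) ≤ V^{π'}(ρ) − V^π(ρ)
  ≤ (1/(1−γ)) Σ_s d_ρ^{π',κ}(s) Σ_a π'(a|s) A^π(s,a)`. -/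
theorem stmt9 {S A : Type*} [Fintype S] [Fintype A] [DecidableEq S]
    (r : S → A → ℝ) (hr : ∀ s a, r s a ∈ Set.Icc (0 : ℝ) 1)
    (γ : ℝ) (hγ0 : 0 < γ) (hγ1 : γ < 1)
    (Pset : S → A → Set (S → ℝ))
    (hPne : ∀ s a, (Pset s a).Nonempty)
    (hPcpt : ∀ s a, IsCompact (Pset s a))
    (hPprob : ∀ s a, ∀ p ∈ Pset s a, (∀ s', 0 ≤ p s') ∧ ∑ s', p s' = 1)
    (π π' : S → A → ℝ)
    (hπ : ∀ s, (∀ a, 0 ≤ π s a) ∧ ∑ a, π s a = 1)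
    (hπ' : ∀ s, (∀ a, 0 ≤ π' s a) ∧ ∑ a, π' s a = 1)
    (κ κ' : S → A → S → ℝ)
    (hκmem : ∀ s a, κ s a ∈ Pset s a) (hκ'mem : ∀ s a, κ' s a ∈ Pset s a)
    (Vπ Vπ' : S → ℝ)
    (hVπ : ∀ s, Vπ s = ∑ a, π s a * (r s a + γ * ∑ s', κ s a s' * Vπ s'))
    (hVπ' : ∀ s, Vπ' s = ∑ a, π' s a * (r s a + γ * ∑ s', κ' s a s' * Vπ' s'))
    (hκworst : ∀ s a, (∑ s', κ s a s' * Vπ s') =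
      sInf {x : ℝ | ∃ p ∈ Pset s a, x = ∑ s', p s' * Vπ s'})
    (hκ'worst : ∀ s a, (∑ s', κ' s a s' * Vπ' s') =
      sInf {x : ℝ | ∃ p ∈ Pset s a, x = ∑ s', p s' * Vπ' s'})
    (ρ : S → ℝ) (hρ0 : ∀ s, 0 ≤ ρ s) (hρ1 : ∑ s, ρ s = 1) :
    let Aadv : S → A → ℝ := fun s a => (r s a + γ * ∑ s', κ s a s' * Vπ s') - Vπ s
    let Pmat : (S → A → S → ℝ) → Matrix S S ℝ :=
      fun k => Matrix.of fun s s' => ∑ a, π' s a * k s a s'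
    let dvis : (S → A → S → ℝ) → S → ℝ := fun k s =>
      (1 - γ) * ∑' t : ℕ, γ ^ t * (((Pmat k)ᵀ ^ t) *ᵥ ρ) s
    (1 / (1 - γ)) * ∑ s, dvis κ' s * ∑ a, π' s a * Aadv s a ≤
        (∑ s, ρ s * Vπ' s) - ∑ s, ρ s * Vπ s ∧
      (∑ s, ρ s * Vπ' s) - ∑ s, ρ s * Vπ s ≤
        (1 / (1 - γ)) * ∑ s, dvis κ s * ∑ a, π' s a * Aadv s a := by
  intro Aadv Pmat dvis
  have hg (s : S) : ∑ a, π' s a * Aadv s a =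
      (∑ a, π' s a * (r s a + γ * ∑ s', κ s a s' * Vπ s')) - Vπ s := by
    simp only [Aadv, mul_sub, Finset.sum_sub_distrib, ← Finset.sum_mul, (hπ' s).2, one_mul]
  have hP0 (k : S → A → S → ℝ) (hk : ∀ s a, k s a ∈ Pset s a) (s s' : S) : 0 ≤ Pmat k s s' :=
    Finset.sum_nonneg fun a _ => mul_nonneg ((hπ' s).1 a) ((hPprob s a _ (hk s a)).1 s')
  have hP1 (k : S → A → S → ℝ) (hk : ∀ s a, k s a ∈ Pset s a) (s : S) :
      ∑ s', Pmat k s s' = 1 := by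
    simp only [Pmat, Matrix.of_apply]
    rw [Finset.sum_comm]
    simp_rw [← Finset.mul_sum, (hPprob s _ _ (hk s _)).2, mul_one]
    exact (hπ' s).2
  have hmix (k : S → A → S → ℝ) (s : S) :
      ∑ s', Pmat k s s' * (Vπ' s' - Vπ s') =
        ∑ a, π' s a * (∑ s', k s a s' * Vπ' s' - ∑ s', k s a s' * Vπ s') := by
    simp only [Pmat, Matrix.of_apply, Finset.sum_mul, ← Finset.sum_sub_distrib, Finset.mul_sum]
    rw [Finset.sum_comm]
    exact Finset.sum_congr rfl fun a _ => Finset.sum_congr rfl fun s' _ => by ring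
  have hdiff (k : S → A → S → ℝ) (s : S) :
      (Vπ' s - Vπ s) - γ * ∑ s', Pmat k s s' * (Vπ' s' - Vπ s') - ∑ a, π' s a * Aadv s a =
        γ * ∑ a, π' s a * ((∑ s', κ' s a s' * Vπ' s' - ∑ s', k s a s' * Vπ' s') +
          (∑ s', k s a s' * Vπ s' - ∑ s', κ s a s' * Vπ s')) := by
    have hpull (c : A → ℝ) : ∑ a, π' s a * (γ * c a) = γ * ∑ a, π' s a * c a := by
      rw [Finset.mul_sum]
      exact Finset.sum_congr rfl fun a _ => mul_left_comm _ _ _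
    rw [hg, hmix, hVπ' s]
    simp only [mul_add, mul_sub, Finset.sum_add_distrib, Finset.sum_sub_distrib, hpull]
    ring
  have hvis (k : S → A → S → ℝ) (f : S → ℝ) :
      (1 / (1 - γ)) * ∑ s, dvis k s * f s = ∑ s, discountedOccupancy γ (Pmat k) ρ s * f s := by
    have : 1 - γ ≠ 0 := by linarith
    simp only [dvis, discountedOccupancy, mul_assoc, ← Finset.mul_sum]
    field_simp
  have hρV : (∑ s, ρ s * Vπ' s) - ∑ s, ρ s * Vπ s = ∑ s, ρ s * (Vπ' s - Vπ s) := by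
    simp only [mul_sub, Finset.sum_sub_distrib]
  have hocc (k : S → A → S → ℝ) (hk : ∀ s a, k s a ∈ Pset s a) :=
    discountedOccupancy_nonneg hγ0.le (hP0 k hk) (hP1 k hk) hρ0 hρ1
  have hflow (k : S → A → S → ℝ) (hk : ∀ s a, k s a ∈ Pset s a) :=
    sum_discountedOccupancy_mul hγ0.le hγ1 (hP0 k hk) (hP1 k hk) hρ0 hρ1
      (fun s => Vπ' s - Vπ s)
  rw [hρV, hvis, hvis]
  constructor
  · rw [← hflow κ' hκ'mem]
    refine Finset.sum_le_sum fun s _ => mul_le_mul_of_nonneg_left ?_ (hocc κ' hκ'mem s)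
    rw [← sub_nonneg, hdiff]
    refine mul_nonneg hγ0.le (Finset.sum_nonneg fun a _ => mul_nonneg ((hπ' s).1 a) ?_)
    rw [sub_self, zero_add, sub_nonneg, hκworst]
    exact sInf_linear_le (hPcpt s a) (hκ'mem s a) Vπ
  · rw [← hflow κ hκmem]
    refine Finset.sum_le_sum fun s _ => mul_le_mul_of_nonneg_left ?_ (hocc κ hκmem s)
    rw [← sub_nonpos, hdiff]
    refine mul_nonpos_of_nonneg_of_nonpos hγ0.le
      (Finset.sum_nonpos fun a _ => mul_nonpos_of_nonneg_of_nonpos ((hπ' s).1 a) ?_)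
    rw [sub_self, add_zero, sub_nonpos, hκ'worst]
    exact sInf_linear_le (hPcpt s a) (hκmem s a) Vπ'
end

section
/- Let p° be a nominal kernel with p°_{s,a} ∈ P_{s,a} for all (s,a), and suppose there exists β ∈ (0,1) with γ·p(s') ≤ β·p°_{s,a}(s') for all s, a, s' and all p ∈ P_{s,a}. Let π* and π be policies admitting worst-case kernels κ_{π*} and κ_π, and suppose V^{π*}(s) ≥ V^π(s) for all s ∈ S. Let d̃_ρ^{π*,p°} := (1−β)Σ_{t≥0} β^t ((P_{p°}^{π*})ᵀ)^t ρ be the β-discounted visitation distribution under the nominal kernel. Then for every probability vector ρ on S: ρᵀ(V^{π*} − V^π) ≤ (1/(1−β))·Σ_s d̃_ρ^{π*,p°}(s)·Σ_a π*(a|s)·A^π(s,a). -/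
open Finset Matrix

/-- Powers of the transpose of a row-stochastic matrix preserve probability vectors. -/
lemma transpose_pow_mulVec_mem_stdSimplex {S : Type*} [Fintype S] [DecidableEq S]
    {M : Matrix S S ℝ} (hM0 : ∀ s s', 0 ≤ M s s') (hM1 : ∀ s, ∑ s', M s s' = 1)
    {ρ : S → ℝ} (hρ : ρ ∈ stdSimplex ℝ S) (t : ℕ) :
    (Mᵀ ^ t) *ᵥ ρ ∈ stdSimplex ℝ S := by
  induction t with
  | zero => simpa using hρ
  | succ t ih =>
    rw [pow_succ', ← mulVec_mulVec]
    refine ⟨fun s => Finset.sum_nonneg fun u _ => mul_nonneg (hM0 u s) (ih.1 u), ?_⟩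
    simp only [mulVec, dotProduct, transpose_apply] at ih ⊢
    rw [Finset.sum_comm]
    simp_rw [← Finset.sum_mul, hM1, one_mul]
    exact ih.2

lemma summable_discounted_occupancy {S : Type*} [Fintype S] [DecidableEq S]
    {M : Matrix S S ℝ} (hM0 : ∀ s s', 0 ≤ M s s') (hM1 : ∀ s, ∑ s', M s s' = 1)
    {ρ : S → ℝ} (hρ : ρ ∈ stdSimplex ℝ S) {β : ℝ} (hβ0 : 0 ≤ β) (hβ1 : β < 1) (s : S) :
    Summable fun t : ℕ => β ^ t * ((Mᵀ ^ t) *ᵥ ρ) s := by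
  have h := transpose_pow_mulVec_mem_stdSimplex hM0 hM1 hρ
  refine Summable.of_nonneg_of_le (fun t => mul_nonneg (pow_nonneg hβ0 t) ((h t).1 s))
    (fun t => mul_le_of_le_one_right (pow_nonneg hβ0 t) ?_)
    (summable_geometric_of_lt_one hβ0 hβ1)
  exact (Finset.single_le_sum (fun u _ => (h t).1 u) (Finset.mem_univ s)).trans_eq (h t).2

/-- The discounted occupancy measure satisfies the balance equation `d = ρ + β Mᵀ d`. -/
lemma discounted_occupancy_eq {S : Type*} [Fintype S] [DecidableEq S]
    {M : Matrix S S ℝ} (hM0 : ∀ s s', 0 ≤ M s s') (hM1 : ∀ s, ∑ s', M s s' = 1)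
    {ρ : S → ℝ} (hρ : ρ ∈ stdSimplex ℝ S) {β : ℝ} (hβ0 : 0 ≤ β) (hβ1 : β < 1) (s : S) :
    ∑' t : ℕ, β ^ t * ((Mᵀ ^ t) *ᵥ ρ) s =
      ρ s + β * ∑ u, M u s * ∑' t : ℕ, β ^ t * ((Mᵀ ^ t) *ᵥ ρ) u := by
  have hs := summable_discounted_occupancy hM0 hM1 hρ hβ0 hβ1
  rw [(hs s).tsum_eq_zero_add]
  congr 1
  · simp
  · simp_rw [← tsum_mul_left]
    rw [← Summable.tsum_finsetSum fun u _ => (hs u).mul_left _, ← tsum_mul_left]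
    refine tsum_congr fun t => ?_
    rw [pow_succ' Mᵀ, ← mulVec_mulVec, mulVec, dotProduct, Finset.mul_sum, Finset.mul_sum]
    refine Finset.sum_congr rfl fun u _ => ?_
    rw [transpose_apply]
    ring

/-- A subsolution `D ≤ g + β M D` is bounded, after averaging over `ρ`, by the integral of `g`
against the discounted occupancy measure. -/
lemma sum_mul_le_of_subsolution {S : Type*} [Fintype S] [DecidableEq S]
    {M : Matrix S S ℝ} (hM0 : ∀ s s', 0 ≤ M s s') (hM1 : ∀ s, ∑ s', M s s' = 1)
    {ρ : S → ℝ} (hρ : ρ ∈ stdSimplex ℝ S) {β : ℝ} (hβ0 : 0 ≤ β) (hβ1 : β < 1)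
    {D g : S → ℝ} (hD : ∀ s, D s ≤ g s + β * ∑ s', M s s' * D s') :
    ∑ s, ρ s * D s ≤ ∑ s, (∑' t : ℕ, β ^ t * ((Mᵀ ^ t) *ᵥ ρ) s) * g s := by
  have hd := discounted_occupancy_eq hM0 hM1 hρ hβ0 hβ1
  have hd0 : ∀ s, 0 ≤ ∑' t : ℕ, β ^ t * ((Mᵀ ^ t) *ᵥ ρ) s := fun s => tsum_nonneg fun t =>
    mul_nonneg (pow_nonneg hβ0 t) ((transpose_pow_mulVec_mem_stdSimplex hM0 hM1 hρ t).1 s)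
  obtain ⟨d, hdef⟩ : ∃ d : S → ℝ, ∀ s, ∑' t : ℕ, β ^ t * ((Mᵀ ^ t) *ᵥ ρ) s = d s :=
    ⟨_, fun _ => rfl⟩
  simp only [hdef] at hd hd0 ⊢
  have h1 : ∑ s, d s * D s ≤ ∑ s, d s * g s + ∑ s, d s * (β * ∑ s', M s s' * D s') := by
    rw [← Finset.sum_add_distrib]
    refine Finset.sum_le_sum fun s _ => ?_
    rw [← mul_add]
    exact mul_le_mul_of_nonneg_left (hD s) (hd0 s)
  have h2 : ∑ s, d s * D s = ∑ s, ρ s * D s + ∑ s, d s * (β * ∑ s', M s s' * D s') := by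
    have h3 : ∑ s, d s * (β * ∑ s', M s s' * D s') = ∑ s, (β * ∑ u, M u s * d u) * D s := by
      simp_rw [Finset.mul_sum, Finset.sum_mul]
      rw [Finset.sum_comm]
      exact Finset.sum_congr rfl fun s _ => Finset.sum_congr rfl fun u _ => by ring
    rw [h3, ← Finset.sum_add_distrib]
    refine Finset.sum_congr rfl fun s _ => ?_
    rw [← add_mul, ← hd s]
  linarith

/-- Robust optimality gap lemma: under the coverage assumption
`γ p ≤ β p°` for all models in the uncertainty set, for policies `π*`, `π`
with `V^{π*} ≥ V^π`,
`ρᵀ(V^{π*} − V^π) ≤ (1/(1−β)) Σ_s d̃_ρ^{π*,p°}(s) Σ_a π*(a|s) A^π(s,a)`,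
where `d̃` is the `β`-discounted visitation under the nominal kernel. -/
theorem stmt10 {S A : Type*} [Fintype S] [Fintype A] [DecidableEq S]
    (r : S → A → ℝ) (hr : ∀ s a, r s a ∈ Set.Icc (0 : ℝ) 1)
    (γ : ℝ) (hγ0 : 0 < γ) (hγ1 : γ < 1)
    (Pset : S → A → Set (S → ℝ))
    (hPne : ∀ s a, (Pset s a).Nonempty)
    (hPcpt : ∀ s a, IsCompact (Pset s a))
    (hPprob : ∀ s a, ∀ p ∈ Pset s a, (∀ s', 0 ≤ p s') ∧ ∑ s', p s' = 1)
    (pnom : S → A → S → ℝ) (hpnommem : ∀ s a, pnom s a ∈ Pset s a)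
    (β : ℝ) (hβ0 : 0 < β) (hβ1 : β < 1)
    (hcover : ∀ s a s', ∀ p ∈ Pset s a, γ * p s' ≤ β * pnom s a s')
    (πstar π : S → A → ℝ)
    (hπstar : ∀ s, (∀ a, 0 ≤ πstar s a) ∧ ∑ a, πstar s a = 1)
    (hπ : ∀ s, (∀ a, 0 ≤ π s a) ∧ ∑ a, π s a = 1)
    (κstar κ : S → A → S → ℝ)
    (hκstarmem : ∀ s a, κstar s a ∈ Pset s a) (hκmem : ∀ s a, κ s a ∈ Pset s a)
    (Vstar Vπ : S → ℝ)
    (hVstar : ∀ s, Vstar s = ∑ a, πstar s a * (r s a + γ * ∑ s', κstar s a s' * Vstar s'))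
    (hVπ : ∀ s, Vπ s = ∑ a, π s a * (r s a + γ * ∑ s', κ s a s' * Vπ s'))
    (hκstarworst : ∀ s a, (∑ s', κstar s a s' * Vstar s') =
      sInf {x : ℝ | ∃ p ∈ Pset s a, x = ∑ s', p s' * Vstar s'})
    (hκworst : ∀ s a, (∑ s', κ s a s' * Vπ s') =
      sInf {x : ℝ | ∃ p ∈ Pset s a, x = ∑ s', p s' * Vπ s'})
    (hdom : ∀ s, Vπ s ≤ Vstar s)
    (ρ : S → ℝ) (hρ0 : ∀ s, 0 ≤ ρ s) (hρ1 : ∑ s, ρ s = 1) :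
    let Aadv : S → A → ℝ := fun s a => (r s a + γ * ∑ s', κ s a s' * Vπ s') - Vπ s
    let Pm : Matrix S S ℝ := Matrix.of fun s s' => ∑ a, πstar s a * pnom s a s'
    let dtil : S → ℝ := fun s => (1 - β) * ∑' t : ℕ, β ^ t * ((Pmᵀ ^ t) *ᵥ ρ) s
    (∑ s, ρ s * (Vstar s - Vπ s)) ≤
      (1 / (1 - β)) * ∑ s, dtil s * ∑ a, πstar s a * Aadv s a := by
  intro Aadv Pm dtil
  have hPm0 : ∀ s s', 0 ≤ Pm s s' := fun s s' => Finset.sum_nonneg fun a _ =>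
    mul_nonneg ((hπstar s).1 a) ((hPprob s a _ (hpnommem s a)).1 s')
  have hPm1 : ∀ s, ∑ s', Pm s s' = 1 := fun s => by
    simp only [Pm, of_apply]
    rw [Finset.sum_comm]
    simp_rw [← Finset.mul_sum, (hPprob s _ _ (hpnommem s _)).2, mul_one]
    exact (hπstar s).2
  have hworst : ∀ s a, ∑ s', κstar s a s' * Vstar s' ≤ ∑ s', κ s a s' * Vstar s' := by
    intro s a
    rw [hκstarworst s a]
    refine csInf_le ?_ ⟨κ s a, hκmem s a, rfl⟩
    have hc : Continuous fun p : S → ℝ => ∑ s', p s' * Vstar s' := by fun_prop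
    refine ((hPcpt s a).image hc).bddBelow.mono ?_
    rintro x ⟨p, hp, rfl⟩
    exact ⟨p, hp, rfl⟩
  have hstep : ∀ s a, γ * ∑ s', κstar s a s' * Vstar s' ≤
      γ * ∑ s', κ s a s' * Vπ s' + β * ∑ s', pnom s a s' * (Vstar s' - Vπ s') := by
    intro s a
    have h1 := mul_le_mul_of_nonneg_left (hworst s a) hγ0.le
    have h2 : ∑ s', (γ * κ s a s') * (Vstar s' - Vπ s') ≤
        ∑ s', (β * pnom s a s') * (Vstar s' - Vπ s') :=
      Finset.sum_le_sum fun s' _ => mul_le_mul_of_nonneg_right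
        (hcover s a s' _ (hκmem s a)) (sub_nonneg.2 (hdom s'))
    simp_rw [mul_assoc, ← Finset.mul_sum] at h2
    simp_rw [mul_sub, Finset.sum_sub_distrib] at h2 ⊢
    linarith
  have hsub : ∀ s, Vstar s - Vπ s ≤
      ∑ a, πstar s a * Aadv s a + β * ∑ s', Pm s s' * (Vstar s' - Vπ s') := by
    intro s
    have hV : Vπ s = ∑ a, πstar s a * Vπ s := by rw [← Finset.sum_mul, (hπstar s).2, one_mul]
    have hPD : β * ∑ s', Pm s s' * (Vstar s' - Vπ s') =
        ∑ a, πstar s a * (β * ∑ s', pnom s a s' * (Vstar s' - Vπ s')) := by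
      simp only [Pm, of_apply, Finset.sum_mul, Finset.mul_sum]
      rw [Finset.sum_comm]
      exact Finset.sum_congr rfl fun a _ => Finset.sum_congr rfl fun s' _ => by ring
    rw [hPD, hVstar s]
    nth_rewrite 1 [hV]
    rw [← Finset.sum_sub_distrib, ← Finset.sum_add_distrib]
    refine Finset.sum_le_sum fun a _ => ?_
    rw [← mul_sub, ← mul_add]
    refine mul_le_mul_of_nonneg_left ?_ ((hπstar s).1 a)
    have := hstep s a
    simp only [Aadv]
    linarith
  refine (sum_mul_le_of_subsolution hPm0 hPm1 ⟨hρ0, hρ1⟩ hβ0.le hβ1 hsub).trans_eq ?_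
  rw [Finset.mul_sum]
  refine Finset.sum_congr rfl fun s _ => ?_
  have hβ : 1 - β ≠ 0 := (sub_pos.2 hβ1).ne'
  simp only [dtil]
  field_simp
end

section
/- Let A be a finite set, η > 0, q ∈ ℝ^A, and let p be a probability vector on A with p(a) > 0 for all a. Define p⁺(a) = p(a)·exp(ηq(a)) / Σ_{a'} p(a')·exp(ηq(a')). Then for every probability vector π on A: η⟨q, π − p⟩ + η⟨q, p − p⁺⟩ ≤ KL(π, p) − KL(π, p⁺) − KL(p⁺, p). -/
open Finset

/-- The log-ratio of a reweighted mass `p * exp t / Z` to `p` is `t - log Z`. -/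
theorem log_mul_exp_div_div_self {p t Z : ℝ} (hp : 0 < p) (hZ : 0 < Z) :
    Real.log (p * Real.exp t / Z / p) = t - Real.log Z := by
  rw [show p * Real.exp t / Z / p = Real.exp t / Z by field_simp,
    Real.log_div (Real.exp_ne_zero t) hZ.ne', Real.log_exp]

/-- Changing the reference mass in a relative-entropy term. -/
theorem mul_log_div_sub_mul_log_div {x y z : ℝ} (hy : y ≠ 0) (hz : z ≠ 0) :
    x * Real.log (x / y) - x * Real.log (x / z) = x * Real.log (z / y) := by
  rcases eq_or_ne x 0 with rfl | hx
  · simp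
  · rw [Real.log_div hx hy, Real.log_div hx hz, Real.log_div hz hy]
    ring

/-- Pushback (fundamental) inequality of the KL mirror-ascent step: with
`p⁺(a) ∝ p(a) exp(η q(a))`, for every probability vector `π`,
`η⟨q, π − p⟩ + η⟨q, p − p⁺⟩ ≤ KL(π,p) − KL(π,p⁺) − KL(p⁺,p)`. -/
theorem stmt12 {A : Type*} [Fintype A] (η : ℝ) (hη : 0 < η) (q : A → ℝ)
    (p : A → ℝ) (hp0 : ∀ a, 0 < p a) (hp1 : ∑ a, p a = 1)
    (π : A → ℝ) (hπ0 : ∀ a, 0 ≤ π a) (hπ1 : ∑ a, π a = 1) :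
    let pplus : A → ℝ := fun a =>
      p a * Real.exp (η * q a) / ∑ a', p a' * Real.exp (η * q a')
    let KL : (A → ℝ) → (A → ℝ) → ℝ := fun x y => ∑ a, x a * Real.log (x a / y a)
    η * (∑ a, q a * (π a - p a)) + η * (∑ a, q a * (p a - pplus a)) ≤
      KL π p - KL π pplus - KL pplus p := by
  intro pplus KL
  have hne : (univ : Finset A).Nonempty := by
    by_contra h
    simp [not_nonempty_iff_eq_empty.mp h] at hp1
  have hZ : 0 < ∑ a, p a * Real.exp (η * q a) :=
    sum_pos (fun a _ => mul_pos (hp0 a) (Real.exp_pos _)) hne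
  have hlog (a : A) : Real.log (pplus a / p a) =
      η * q a - Real.log (∑ a, p a * Real.exp (η * q a)) :=
    log_mul_exp_div_div_self (hp0 a) hZ
  have hpos (a : A) : 0 < pplus a := div_pos (mul_pos (hp0 a) (Real.exp_pos _)) hZ
  have hsum : ∑ a, pplus a = 1 := by
    rw [← sum_div, div_self hZ.ne']
  have hexpect (x : A → ℝ) (hx : ∑ a, x a = 1) :
      ∑ a, x a * Real.log (pplus a / p a) =
        η * ∑ a, q a * x a - Real.log (∑ a, p a * Real.exp (η * q a)) := by
    simp only [hlog, mul_sub, sum_sub_distrib, ← sum_mul, hx, one_mul, mul_sum]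
    congr 1
    exact sum_congr rfl fun a _ => by ring
  have hdiff : KL π p - KL π pplus = ∑ a, π a * Real.log (pplus a / p a) := by
    simp only [KL, ← sum_sub_distrib]
    exact sum_congr rfl fun a _ => mul_log_div_sub_mul_log_div (hp0 a).ne' (hpos a).ne'
  rw [hdiff, hexpect π hπ1, show KL pplus p = _ from hexpect pplus hsum]
  simp only [mul_sub, sum_sub_distrib]
  linarith
end

section
/- Let π be a policy with π(a|s) > 0 for all (s,a), Q̂: S×A → ℝ, η > 0, and π⁺(a|s) = π(a|s)·exp(ηQ̂(s,a))/Σ_{a'}π(a'|s)·exp(ηQ̂(s,a')). Suppose π and π⁺ admit worst-case kernels κ_π and κ_{π⁺}. Then: (i) Σ_a Q̂(s,a)(π⁺(a|s) − π(a|s)) ≥ 0 for every s ∈ S; and (ii) for every s ∈ S, Σ_a Q̂(s,a)(π(a|s) − π⁺(a|s)) ≥ V^π(s) − V^{π⁺}(s) + (1/(1−γ))·Σ_{s'} d_s^{π⁺,κ_{π⁺}}(s')·Σ_a (Q̂(s',a) − Q^π(s',a))·(π(a|s') − π⁺(a|s')), where d_s^{π⁺,κ_{π⁺}} is the discounted visitation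 distribution started from the point mass at s. -/
open Finset Matrix

/-- Tilting a probability vector exponentially in the direction `q` does not decrease the mean
of `q`. -/
lemma mean_le_mean_exp_tilt {A : Type*} [Fintype A] {w q : A → ℝ} (hw : ∀ a, 0 < w a)
    (hw1 : ∑ a, w a = 1) {η : ℝ} (hη : 0 ≤ η) :
    0 ≤ ∑ a, q a * (w a * Real.exp (η * q a) / (∑ a', w a' * Real.exp (η * q a')) - w a) := by
  set Z := ∑ a', w a' * Real.exp (η * q a') with hZ
  have hA : (univ : Finset A).Nonempty := by
    by_contra h
    simp [not_nonempty_iff_eq_empty.1 h] at hw1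
  have hZpos : 0 < Z := sum_pos (fun a _ => mul_pos (hw a) (Real.exp_pos _)) hA
  set m := ∑ a, w a * q a with hm
  have hterm : 0 ≤ ∑ a, w a * ((q a - m) * (Real.exp (η * q a) - Real.exp (η * m))) := by
    refine sum_nonneg fun a _ => mul_nonneg (hw a).le ?_
    rcases le_total m (q a) with h | h
    · exact mul_nonneg (sub_nonneg.2 h)
        (sub_nonneg.2 (Real.exp_le_exp.2 (mul_le_mul_of_nonneg_left h hη)))
    · exact mul_nonneg_of_nonpos_of_nonpos (sub_nonpos.2 h)
        (sub_nonpos.2 (Real.exp_le_exp.2 (mul_le_mul_of_nonneg_left h hη)))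
  have hexpand : ∀ c e : ℝ, ∑ a, w a * ((q a - c) * (Real.exp (η * q a) - e))
      = ∑ a, w a * Real.exp (η * q a) * q a - c * Z
        - e * (∑ a, w a * q a - c * ∑ a, w a) := fun c e => by
    rw [hZ, mul_sum, mul_sum, ← sum_sub_distrib, ← sum_sub_distrib, mul_sum, ← sum_sub_distrib]
    exact sum_congr rfl fun a _ => by ring
  rw [hexpand, hw1, ← hm] at hterm
  have hgoal : ∑ a, q a * (w a * Real.exp (η * q a) / Z - w a)
      = (∑ a, w a * Real.exp (η * q a) * q a - m * Z) / Z := by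
    rw [sub_div, mul_div_cancel_right₀ _ hZpos.ne', sum_div, hm, ← sum_sub_distrib]
    exact sum_congr rfl fun a _ => by ring
  rw [hgoal]
  exact div_nonneg (by linarith) hZpos.le

/-- The discounted occupancy series of a stochastic matrix started at `s₀` is nonnegative and
solves the flow equation. -/
lemma discounted_occupancy_nonneg_and_flow {S : Type*} [Fintype S] [DecidableEq S]
    {P : Matrix S S ℝ} (hP0 : ∀ s s', 0 ≤ P s s') (hP1 : ∀ s, ∑ s', P s s' = 1)
    {γ : ℝ} (hγ0 : 0 ≤ γ) (hγ1 : γ < 1) (s₀ : S) (D : S → ℝ)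
    (hD : ∀ s, D s = ∑' t : ℕ, γ ^ t * ((Pᵀ ^ t) *ᵥ Pi.single s₀ 1) s) :
    (∀ s, 0 ≤ D s) ∧
      ∀ s, D s = (Pi.single s₀ 1 : S → ℝ) s + γ * ∑ s', P s' s * D s' := by
  set u : ℕ → S → ℝ := fun t => (Pᵀ ^ t) *ᵥ Pi.single s₀ 1 with hu
  have hsucc : ∀ t s, u (t + 1) s = ∑ s', P s' s * u t s' := fun t s => by
    simp only [hu, pow_succ', ← mulVec_mulVec]
    simp [mulVec, dotProduct]
  have hu0 : ∀ s, u 0 s = (Pi.single s₀ 1 : S → ℝ) s := fun s => by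
    simp only [hu, pow_zero, one_mulVec]
  have hnn : ∀ t s, 0 ≤ u t s := by
    intro t
    induction t with
    | zero =>
      intro s
      rw [hu0, Pi.single_apply]
      split_ifs <;> norm_num
    | succ t ih =>
      intro s
      rw [hsucc]
      exact sum_nonneg fun s' _ => mul_nonneg (hP0 _ _) (ih s')
  have hsum : ∀ t, ∑ s, u t s = 1 := by
    intro t
    induction t with
    | zero => simp [hu0]
    | succ t ih =>
      simp only [hsucc]
      rw [sum_comm]
      simp only [← sum_mul, hP1, one_mul, ih]
  have hle : ∀ t s, u t s ≤ 1 := fun t s =>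
    (single_le_sum (fun s' _ => hnn t s') (mem_univ s)).trans (hsum t).le
  have hsummable : ∀ s, Summable fun t => γ ^ t * u t s := fun s =>
    Summable.of_nonneg_of_le (fun t => mul_nonneg (pow_nonneg hγ0 t) (hnn t s))
      (fun t => mul_le_of_le_one_right (pow_nonneg hγ0 t) (hle t s))
      (summable_geometric_of_lt_one hγ0 hγ1)
  refine ⟨fun s => ?_, fun s => ?_⟩
  · rw [hD]
    exact tsum_nonneg fun t => mul_nonneg (pow_nonneg hγ0 t) (hnn t s)
  · rw [hD, (hsummable s).tsum_eq_zero_add, pow_zero, one_mul, hu0]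
    congr 1
    simp only [hD]
    simp_rw [← tsum_mul_left]
    rw [← Summable.tsum_finsetSum fun s' _ => (hsummable s').mul_left _, ← tsum_mul_left]
    refine tsum_congr fun t => ?_
    rw [hsucc, mul_sum, mul_sum]
    exact sum_congr rfl fun s' _ => by ring

/-- Summing `h - γ P h` against a solution of the flow equation recovers `h s₀`. -/
lemma sum_flow_mul_sub_eq {S : Type*} [Fintype S] [DecidableEq S] {P : Matrix S S ℝ} {γ : ℝ}
    {s₀ : S} {D : S → ℝ}
    (hflow : ∀ s, D s = (Pi.single s₀ 1 : S → ℝ) s + γ * ∑ s', P s' s * D s') (h : S → ℝ) :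
    ∑ s, D s * (h s - γ * ∑ s', P s s' * h s') = h s₀ := by
  have h1 : ∑ s, D s * h s = h s₀ + ∑ s, (γ * ∑ s', P s' s * D s') * h s := by
    conv_lhs => enter [2, s]; rw [hflow s]
    simp [add_mul, sum_add_distrib, Pi.single_apply]
  have h2 : ∑ s, (γ * ∑ s', P s' s * D s') * h s = ∑ s, D s * (γ * ∑ s', P s s' * h s') := by
    simp only [mul_sum, sum_mul]
    rw [sum_comm]
    exact sum_congr rfl fun s _ => sum_congr rfl fun s' _ => by ring
  simp only [mul_sub, sum_sub_distrib]
  linarith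

/-- One-step properties of the exponential policy update `π⁺ ∝ π e^{ηQ̂}`:
(i) `Σ_a Q̂(s,a)(π⁺(a|s) − π(a|s)) ≥ 0` for every `s`; and
(ii) `Σ_a Q̂(s,a)(π(a|s) − π⁺(a|s)) ≥ V^π(s) − V^{π⁺}(s)
      + (1/(1−γ)) Σ_{s'} d_s^{π⁺,κ_{π⁺}}(s') Σ_a (Q̂(s',a) − Q^π(s',a))(π(a|s') − π⁺(a|s'))`. -/
theorem stmt15 {S A : Type*} [Fintype S] [Fintype A] [DecidableEq S]
    (r : S → A → ℝ) (hr : ∀ s a, r s a ∈ Set.Icc (0 : ℝ) 1)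
    (γ : ℝ) (hγ0 : 0 < γ) (hγ1 : γ < 1)
    (Pset : S → A → Set (S → ℝ))
    (hPne : ∀ s a, (Pset s a).Nonempty)
    (hPcpt : ∀ s a, IsCompact (Pset s a))
    (hPprob : ∀ s a, ∀ p ∈ Pset s a, (∀ s', 0 ≤ p s') ∧ ∑ s', p s' = 1)
    (π : S → A → ℝ) (hπpos : ∀ s a, 0 < π s a) (hπ1 : ∀ s, ∑ a, π s a = 1)
    (Qhat : S → A → ℝ) (η : ℝ) (hη : 0 < η)
    (πplus : S → A → ℝ)
    (hπplus : ∀ s a, πplus s a =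
      π s a * Real.exp (η * Qhat s a) / ∑ a', π s a' * Real.exp (η * Qhat s a'))
    (κπ κp : S → A → S → ℝ)
    (hκπmem : ∀ s a, κπ s a ∈ Pset s a) (hκpmem : ∀ s a, κp s a ∈ Pset s a)
    (Vπ Vp : S → ℝ)
    (hVπ : ∀ s, Vπ s = ∑ a, π s a * (r s a + γ * ∑ s', κπ s a s' * Vπ s'))
    (hVp : ∀ s, Vp s = ∑ a, πplus s a * (r s a + γ * ∑ s', κp s a s' * Vp s'))
    (hκπworst : ∀ s a, (∑ s', κπ s a s' * Vπ s') =
      sInf {x : ℝ | ∃ p ∈ Pset s a, x = ∑ s', p s' * Vπ s'})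
    (hκpworst : ∀ s a, (∑ s', κp s a s' * Vp s') =
      sInf {x : ℝ | ∃ p ∈ Pset s a, x = ∑ s', p s' * Vp s'}) :
    let Pm : Matrix S S ℝ := Matrix.of fun s s' => ∑ a, πplus s a * κp s a s'
    let dvis : S → S → ℝ := fun s₀ s' =>
      (1 - γ) * ∑' t : ℕ, γ ^ t * ((Pmᵀ ^ t) *ᵥ Pi.single s₀ 1) s'
    let Qπ : S → A → ℝ := fun s a => r s a + γ * ∑ s', κπ s a s' * Vπ s'
    (∀ s, 0 ≤ ∑ a, Qhat s a * (πplus s a - π s a)) ∧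
      ∀ s, ∑ a, Qhat s a * (π s a - πplus s a) ≥
        Vπ s - Vp s + (1 / (1 - γ)) * ∑ s', dvis s s' *
          ∑ a, (Qhat s' a - Qπ s' a) * (π s' a - πplus s' a) := by
  intro Pm dvis Qπ
  have hpart : ∀ s, 0 ≤ ∑ a, Qhat s a * (πplus s a - π s a) := fun s => by
    simp only [hπplus]
    exact mean_le_mean_exp_tilt (hπpos s) (hπ1 s) hη.le
  refine ⟨hpart, fun s => ?_⟩
  have hA : (univ : Finset A).Nonempty := by
    by_contra h
    have := hπ1 s
    simp [not_nonempty_iff_eq_empty.1 h] at this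
  have hZ : ∀ s, 0 < ∑ a', π s a' * Real.exp (η * Qhat s a') := fun s =>
    sum_pos (fun a _ => mul_pos (hπpos s a) (Real.exp_pos _)) hA
  have hp0 : ∀ s a, 0 ≤ πplus s a := fun s a => by
    rw [hπplus]
    exact div_nonneg (mul_nonneg (hπpos s a).le (Real.exp_pos _).le) (hZ s).le
  have hp1 : ∀ s, ∑ a, πplus s a = 1 := fun s => by
    simp only [hπplus, ← sum_div]
    exact div_self (hZ s).ne'
  have hPm : ∀ s s', Pm s s' = ∑ a, πplus s a * κp s a s' := fun s s' => rfl
  have hPm0 : ∀ s s', 0 ≤ Pm s s' := fun s s' =>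
    sum_nonneg fun a _ => mul_nonneg (hp0 s a) ((hPprob s a _ (hκpmem s a)).1 s')
  have hPm1 : ∀ s, ∑ s', Pm s s' = 1 := fun s => by
    simp only [hPm]
    rw [sum_comm]
    simp only [← mul_sum, (hPprob _ _ _ (hκpmem _ _)).2, mul_one, hp1]
  have hPmV : ∀ (s : S) (V : S → ℝ),
      ∑ s', Pm s s' * V s' = ∑ a, πplus s a * ∑ s', κp s a s' * V s' := fun s V => by
    simp only [hPm, sum_mul, mul_sum]
    rw [sum_comm]
    exact sum_congr rfl fun a _ => sum_congr rfl fun s' _ => by ring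
  have hworst : ∀ s a, ∑ s', κπ s a s' * Vπ s' ≤ ∑ s', κp s a s' * Vπ s' := fun s a => by
    rw [hκπworst s a]
    refine csInf_le ?_ ⟨κp s a, hκpmem s a, rfl⟩
    have hset : {x : ℝ | ∃ p ∈ Pset s a, x = ∑ s', p s' * Vπ s'}
        = (fun p : S → ℝ => ∑ s', p s' * Vπ s') '' Pset s a := by
      ext x
      simp [eq_comm]
    rw [hset]
    exact ((hPcpt s a).image (by fun_prop)).bddBelow
  set D : S → ℝ := fun s' => ∑' t : ℕ, γ ^ t * ((Pmᵀ ^ t) *ᵥ Pi.single s 1) s' with hD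
  obtain ⟨hD0, hflow⟩ := discounted_occupancy_nonneg_and_flow hPm0 hPm1 hγ0.le hγ1 s D fun _ => rfl
  have hγ : 1 - γ ≠ 0 := by linarith
  have hnorm : ∀ g : S → ℝ, 1 / (1 - γ) * ∑ s', dvis s s' * g s' = ∑ s', D s' * g s' := fun g => by
    rw [mul_sum]
    refine sum_congr rfl fun s' _ => ?_
    change 1 / (1 - γ) * ((1 - γ) * D s' * g s') = _
    field_simp
  have hadv : ∀ s', (Vπ s' - Vp s') - γ * ∑ s'', Pm s' s'' * (Vπ s'' - Vp s'')
      ≤ ∑ a, Qπ s' a * (π s' a - πplus s' a) := fun s' => by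
    have h1 : ∑ a, Qπ s' a * (π s' a - πplus s' a) = Vπ s' - ∑ a, πplus s' a * Qπ s' a := by
      rw [hVπ s', ← sum_sub_distrib]
      exact sum_congr rfl fun a _ => by simp only [Qπ]; ring
    have h2 : ∑ a, πplus s' a * Qπ s' a
        ≤ ∑ a, πplus s' a * (r s' a + γ * ∑ s'', κp s' a s'' * Vπ s'') :=
      sum_le_sum fun a _ => mul_le_mul_of_nonneg_left
        (add_le_add_right (mul_le_mul_of_nonneg_left (hworst s' a) hγ0.le) _) (hp0 s' a)
    have h3 : ∀ V : S → ℝ, ∑ a, πplus s' a * (r s' a + γ * ∑ s'', κp s' a s'' * V s'')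
        = ∑ a, πplus s' a * r s' a + γ * ∑ s'', Pm s' s'' * V s'' := fun V => by
      rw [hPmV, mul_sum, ← sum_add_distrib]
      exact sum_congr rfl fun a _ => by ring
    have h4 := hVp s'
    rw [h3] at h2 h4
    rw [h1]
    simp only [mul_sub, sum_sub_distrib]
    linarith
  have hdiff : Vπ s - Vp s ≤ ∑ s', D s' * ∑ a, Qπ s' a * (π s' a - πplus s' a) := by
    rw [← sum_flow_mul_sub_eq hflow fun s' => Vπ s' - Vp s']
    exact sum_le_sum fun s' _ => mul_le_mul_of_nonneg_left (hadv s') (hD0 s')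
  have hneg : ∀ s', ∑ a, Qhat s' a * (π s' a - πplus s' a) ≤ 0 := fun s' => by
    have h : ∑ a, Qhat s' a * (π s' a - πplus s' a)
        = -∑ a, Qhat s' a * (πplus s' a - π s' a) := by
      rw [← sum_neg_distrib]
      exact sum_congr rfl fun a _ => by ring
    linarith [hpart s']
  have hDs : 1 ≤ D s := by
    rw [hflow s, Pi.single_eq_same]
    exact le_add_of_nonneg_right
      (mul_nonneg hγ0.le (sum_nonneg fun s' _ => mul_nonneg (hPm0 _ _) (hD0 s')))
  have hhat : ∑ s', D s' * ∑ a, Qhat s' a * (π s' a - πplus s' a)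
      ≤ ∑ a, Qhat s a * (π s a - πplus s a) := by
    rw [← add_sum_erase _ _ (mem_univ s)]
    have h1 : ∑ s' ∈ univ.erase s, D s' * ∑ a, Qhat s' a * (π s' a - πplus s' a) ≤ 0 :=
      sum_nonpos fun s' _ => mul_nonpos_of_nonneg_of_nonpos (hD0 s') (hneg s')
    have h2 := mul_le_mul_of_nonpos_right hDs (hneg s)
    linarith
  rw [hnorm]
  have hsplit : ∑ s', D s' * ∑ a, (Qhat s' a - Qπ s' a) * (π s' a - πplus s' a)
      = ∑ s', D s' * ∑ a, Qhat s' a * (π s' a - πplus s' a)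
        - ∑ s', D s' * ∑ a, Qπ s' a * (π s' a - πplus s' a) := by
    simp only [sub_mul, sum_sub_distrib, mul_sub]
    ring
  rw [hsplit]
  linarith
end

section
/- Let S be a finite set, ν a probability vector on S with ν(s) > 0 for all s, D = diag(ν), and Ψ ∈ ℝ^{S×d} with linearly independent columns; let Π = Ψ(ΨᵀDΨ)^{-1}ΨᵀD and let λ_min > 0 be the smallest eigenvalue of ΨᵀDΨ. Let T: ℝ^S → ℝ^S and β ∈ [0,1) satisfy ‖ΠT(Ψw) − ΠT(Ψw')‖_ν ≤ β‖Ψw − Ψw'‖_ν for all w, w' ∈ ℝ^d, and let w* ∈ ℝ^d satisfy ΨᵀD(T(Ψw*) − Ψw*) = 0. Then for every w ∈ ℝ^d: ⟨w − w*, ΨᵀD(T(Ψw) − Ψw)⟩ ≤ −(1−β)·λ_min·‖w − w*‖₂². -/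
open Finset Matrix

/-- A real symmetric matrix whose eigenvalues are all at least `c` dominates `c` times the
identity as a quadratic form. -/
theorem Matrix.IsHermitian.mul_dotProduct_self_le {n : Type*} [Fintype n] [DecidableEq n]
    {A : Matrix n n ℝ} (hA : A.IsHermitian) {c : ℝ}
    (hc : ∀ (x : n → ℝ) (μ : ℝ), x ≠ 0 → A *ᵥ x = μ • x → c ≤ μ) (u : n → ℝ) :
    c * (u ⬝ᵥ u) ≤ u ⬝ᵥ (A *ᵥ u) := by
  have hB : (A - c • (1 : Matrix n n ℝ)).IsHermitian :=
    hA.sub (isHermitian_one.smul (IsSelfAdjoint.all c))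
  have hpos : (A - c • (1 : Matrix n n ℝ)).PosSemidef := by
    rw [hB.posSemidef_iff_eigenvalues_nonneg]
    intro i
    have hv := hB.mulVec_eigenvectorBasis i
    have hne : (hB.eigenvectorBasis i).ofLp ≠ 0 := by
      intro h
      exact hB.eigenvectorBasis.toBasis.ne_zero i (by ext j; simpa using congrFun h j)
    have := hc _ (hB.eigenvalues i + c) hne (by
      rw [sub_mulVec, smul_mulVec, one_mulVec, sub_eq_iff_eq_add] at hv
      rw [hv, add_smul])
    simpa using this
  have h := hpos.dotProduct_mulVec_nonneg u
  simp only [star_trivial, sub_mulVec, smul_mulVec, one_mulVec, dotProduct_sub, dotProduct_smul,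
    smul_eq_mul] at h
  linarith

/-- The weighted Cauchy–Schwarz inequality for finite sums. -/
theorem Finset.sum_weight_mul_le_sqrt_mul_sqrt {ι : Type*} (s : Finset ι) {ν : ι → ℝ}
    (hν : ∀ i, 0 ≤ ν i) (f g : ι → ℝ) :
    ∑ i ∈ s, ν i * (f i * g i) ≤
      √(∑ i ∈ s, ν i * f i ^ 2) * √(∑ i ∈ s, ν i * g i ^ 2) := by
  have h := Real.sum_mul_le_sqrt_mul_sqrt s (fun i => √(ν i) * f i) (fun i => √(ν i) * g i)
  simp only [mul_pow, Real.sq_sqrt (hν _)] at h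
  refine le_trans (le_of_eq (Finset.sum_congr rfl fun i _ => ?_)) h
  linear_combination -(f i * g i) * Real.sq_sqrt (hν i)

/-- The bilinear form of `Ψᵀ D` written as a weighted sum. -/
theorem Matrix.dotProduct_transpose_mul_diagonal_mulVec {m n : Type*} [Fintype m] [Fintype n]
    [DecidableEq m] (Ψ : Matrix m n ℝ) (ν : m → ℝ) (u : n → ℝ) (v : m → ℝ) :
    u ⬝ᵥ ((Ψᵀ * diagonal ν) *ᵥ v) = ∑ s, ν s * ((Ψ *ᵥ u) s * v s) := by
  rw [← mulVec_mulVec, dotProduct_mulVec, vecMul_transpose]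
  simp only [dotProduct, mulVec_diagonal]
  exact Finset.sum_congr rfl fun s _ => by ring

/-- Strong monotonicity of the robust linear-TD update direction: if `ΠT` is a
`β`-contraction on the linear class w.r.t. `‖·‖_ν` and `w*` is the projected
fixed point (`ΨᵀD(T(Ψw*) − Ψw*) = 0`), then
`⟨w − w*, ΨᵀD(T(Ψw) − Ψw)⟩ ≤ −(1−β) λ_min ‖w − w*‖₂²`. -/
theorem stmt17 {S : Type*} [Fintype S] [DecidableEq S] {d : ℕ}
    (ν : S → ℝ) (hν : ∀ s, 0 < ν s) (hν1 : ∑ s, ν s = 1)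
    (Ψ : Matrix S (Fin d) ℝ)
    (hΨ : LinearIndependent ℝ (fun j : Fin d => fun s : S => Ψ s j))
    (lammin : ℝ) (hlampos : 0 < lammin)
    (hlam : IsLeast {μ : ℝ | ∃ x : Fin d → ℝ, x ≠ 0 ∧
      (Ψᵀ * Matrix.diagonal ν * Ψ) *ᵥ x = μ • x} lammin)
    (T : (S → ℝ) → S → ℝ) (β : ℝ) (hβ0 : 0 ≤ β) (hβ1 : β < 1)
    (hcontr : ∀ w w' : Fin d → ℝ,
      Real.sqrt (∑ s, ν s *
        (((Ψ * (Ψᵀ * Matrix.diagonal ν * Ψ)⁻¹ * Ψᵀ * Matrix.diagonal ν) *ᵥ T (Ψ *ᵥ w)) s -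
         ((Ψ * (Ψᵀ * Matrix.diagonal ν * Ψ)⁻¹ * Ψᵀ * Matrix.diagonal ν) *ᵥ T (Ψ *ᵥ w')) s) ^ 2) ≤
        β * Real.sqrt (∑ s, ν s * ((Ψ *ᵥ w) s - (Ψ *ᵥ w') s) ^ 2))
    (wstar : Fin d → ℝ)
    (hfix : (Ψᵀ * Matrix.diagonal ν) *ᵥ (T (Ψ *ᵥ wstar) - Ψ *ᵥ wstar) = 0) :
    ∀ w : Fin d → ℝ,
      (w - wstar) ⬝ᵥ ((Ψᵀ * Matrix.diagonal ν) *ᵥ (T (Ψ *ᵥ w) - Ψ *ᵥ w)) ≤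
        -((1 - β) * lammin) * ∑ i, (w i - wstar i) ^ 2 := by
  intro w
  set A := Ψᵀ * Matrix.diagonal ν * Ψ with hA
  have hAherm : A.IsHermitian := by
    rw [IsHermitian, conjTranspose_eq_transpose_of_trivial, hA]
    simp [Matrix.mul_assoc]
  have hdet : IsUnit A.det := by
    rw [isUnit_iff_ne_zero]
    intro h
    obtain ⟨x, hx, hAx⟩ := exists_mulVec_eq_zero_iff.2 h
    exact hlampos.not_ge (hlam.2 ⟨x, hx, by rw [hAx, zero_smul]⟩)
  have hray := hAherm.mul_dotProduct_self_le
    (fun x μ hx hμ => hlam.2 ⟨x, hx, hμ⟩) (w - wstar)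
  have hquad : (w - wstar) ⬝ᵥ (A *ᵥ (w - wstar)) =
      ∑ s, ν s * ((Ψ *ᵥ w) s - (Ψ *ᵥ wstar) s) ^ 2 := by
    rw [hA, ← mulVec_mulVec, dotProduct_transpose_mul_diagonal_mulVec]
    simp only [mulVec_sub, Pi.sub_apply, sq]
  set P := Ψ * A⁻¹ * Ψᵀ * Matrix.diagonal ν with hP
  have hGP : Ψᵀ * Matrix.diagonal ν * P = Ψᵀ * Matrix.diagonal ν := by
    calc Ψᵀ * Matrix.diagonal ν * P = A * A⁻¹ * (Ψᵀ * Matrix.diagonal ν) := by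
          simp only [hP, hA, Matrix.mul_assoc]
      _ = Ψᵀ * Matrix.diagonal ν := by rw [mul_nonsing_inv _ hdet, Matrix.one_mul]
  have hsplit : (Ψᵀ * Matrix.diagonal ν) *ᵥ (T (Ψ *ᵥ w) - Ψ *ᵥ w) =
      (Ψᵀ * Matrix.diagonal ν) *ᵥ (P *ᵥ T (Ψ *ᵥ w) - P *ᵥ T (Ψ *ᵥ wstar)) -
        A *ᵥ (w - wstar) := by
    rw [mulVec_sub, sub_eq_zero] at hfix
    rw [mulVec_sub, mulVec_sub, mulVec_sub, mulVec_mulVec _ _ P, mulVec_mulVec _ _ P, hGP, hfix,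
      hA, ← mulVec_mulVec w, ← mulVec_mulVec wstar]
    abel
  have hcs := Finset.univ.sum_weight_mul_le_sqrt_mul_sqrt (fun s => (hν s).le)
    (Ψ *ᵥ (w - wstar)) (P *ᵥ T (Ψ *ᵥ w) - P *ᵥ T (Ψ *ᵥ wstar))
  rw [← dotProduct_transpose_mul_diagonal_mulVec] at hcs
  simp only [mulVec_sub Ψ, Pi.sub_apply] at hcs
  have hsq := Real.mul_self_sqrt (Finset.sum_nonneg fun s (_ : s ∈ Finset.univ) =>
    mul_nonneg (hν s).le (sq_nonneg ((Ψ *ᵥ w) s - (Ψ *ᵥ wstar) s)))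
  have hle := mul_le_mul_of_nonneg_left (hcontr w wstar)
    (Real.sqrt_nonneg (∑ s, ν s * ((Ψ *ᵥ w) s - (Ψ *ᵥ wstar) s) ^ 2))
  have hnorm : ∑ i, (w i - wstar i) ^ 2 = (w - wstar) ⬝ᵥ (w - wstar) := by
    simp only [dotProduct, Pi.sub_apply, sq]
  rw [hsplit, dotProduct_sub, hnorm, hquad]
  rw [hquad] at hray
  have hmono := mul_le_mul_of_nonneg_left hray (sub_nonneg.2 hβ1.le)
  linear_combination hcs + hle + hmono + β * hsq
end

section
/- Let S and A be finite sets, ψ: S → ℝ^d, r: S×A → [0,1], γ ∈ (0,1), m ≥ 1, and let K be a nonempty subset of the probability simplex Δ_m ⊂ ℝ^m. For x = (s, a, (s₁,…,s_m)) ∈ S×A×S^m and w ∈ ℝ^d, define F(w, x) = ψ(s)·( r(s,a) + γ·inf_{α∈K} Σ_{i=1}^m α_i·ψ(s_i)ᵀw − ψ(s)ᵀw ) ∈ ℝ^d. Then for all w, w' ∈ ℝ^d and all x: ‖F(w, x) − F(w', x)‖₂ ≤ (1+γ)·(max_{s∈S}‖ψ(s)‖₂)²·‖w − w'‖₂. 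-/
open Finset

theorem abs_sum_mul_le_sqrt_mul_sqrt {ι : Type*} (s : Finset ι) (a b : ι → ℝ) :
    |∑ j ∈ s, a j * b j| ≤ Real.sqrt (∑ j ∈ s, a j ^ 2) * Real.sqrt (∑ j ∈ s, b j ^ 2) := by
  rw [← Real.sqrt_mul (Finset.sum_nonneg fun _ _ => sq_nonneg _)]
  exact Real.abs_le_sqrt (Finset.sum_mul_sq_le_sq_mul_sq s a b)

/-- The lower expectation over a set of weights is monotone up to an additive constant. -/
theorem sInf_weightedSum_le_add {ι : Type*} [Fintype ι] {K : Set (ι → ℝ)}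
    (hKne : K.Nonempty) (hKsub : ∀ α ∈ K, (∀ i, 0 ≤ α i) ∧ ∑ i, α i = 1)
    {u v : ι → ℝ} {C : ℝ} (h : ∀ i, u i ≤ v i + C) :
    sInf {y : ℝ | ∃ α ∈ K, y = ∑ i, α i * u i} ≤
      sInf {y : ℝ | ∃ α ∈ K, y = ∑ i, α i * v i} + C := by
  have hbdd : BddBelow {y : ℝ | ∃ α ∈ K, y = ∑ i, α i * u i} := by
    refine ⟨∑ i, -|u i|, ?_⟩
    rintro y ⟨α, hα, rfl⟩
    obtain ⟨h0, h1⟩ := hKsub α hα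
    refine Finset.sum_le_sum fun i _ => ?_
    have hi : α i ≤ 1 := h1 ▸ Finset.single_le_sum (fun j _ => h0 j) (Finset.mem_univ i)
    nlinarith [neg_abs_le (u i), abs_nonneg (u i), h0 i]
  rw [← sub_le_iff_le_add]
  obtain ⟨α₀, hα₀⟩ := hKne
  refine le_csInf ⟨_, α₀, hα₀, rfl⟩ ?_
  rintro y ⟨α, hα, rfl⟩
  obtain ⟨h0, h1⟩ := hKsub α hα
  rw [sub_le_iff_le_add]
  calc sInf {y : ℝ | ∃ α ∈ K, y = ∑ i, α i * u i} ≤ ∑ i, α i * u i :=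
        csInf_le hbdd ⟨α, hα, rfl⟩
    _ ≤ ∑ i, α i * (v i + C) :=
        Finset.sum_le_sum fun i _ => mul_le_mul_of_nonneg_left (h i) (h0 i)
    _ = ∑ i, α i * v i + C := by
        simp only [mul_add, Finset.sum_add_distrib, ← Finset.sum_mul, h1, one_mul]

/-- Lipschitz continuity of the robust linear-TD update direction for the
double-sampling uncertainty set:
`‖F(w,x) − F(w',x)‖₂ ≤ (1+γ)(max_s ‖ψ(s)‖₂)² ‖w − w'‖₂`. -/
theorem stmt18 {S A : Type*} [Fintype S] [Fintype A] [Nonempty S] {d m : ℕ}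
    (hm : 1 ≤ m)
    (ψ : S → Fin d → ℝ)
    (r : S → A → ℝ) (hr : ∀ s a, r s a ∈ Set.Icc (0 : ℝ) 1)
    (γ : ℝ) (hγ0 : 0 < γ) (hγ1 : γ < 1)
    (K : Set (Fin m → ℝ)) (hKne : K.Nonempty)
    (hKsub : ∀ α ∈ K, (∀ i, 0 ≤ α i) ∧ ∑ i, α i = 1) :
    let F : (Fin d → ℝ) → S × A × (Fin m → S) → Fin d → ℝ := fun w x j =>
      ψ x.1 j * (r x.1 x.2.1 +
        γ * sInf {y : ℝ | ∃ α ∈ K, y = ∑ i, α i * ∑ j', ψ (x.2.2 i) j' * w j'} -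
        ∑ j', ψ x.1 j' * w j')
    ∀ (w w' : Fin d → ℝ) (x : S × A × (Fin m → S)),
      Real.sqrt (∑ j, (F w x j - F w' x j) ^ 2) ≤
        (1 + γ) * (⨆ s : S, Real.sqrt (∑ j, ψ s j ^ 2)) ^ 2 *
          Real.sqrt (∑ j, (w j - w' j) ^ 2) := by
  intro F w w' x
  set M : ℝ := ⨆ s : S, Real.sqrt (∑ j, ψ s j ^ 2) with hM
  set D : ℝ := Real.sqrt (∑ j, (w j - w' j) ^ 2) with hD
  have hle : ∀ s, Real.sqrt (∑ j, ψ s j ^ 2) ≤ M := fun s =>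
    le_ciSup (f := fun s => Real.sqrt (∑ j, ψ s j ^ 2)) (Set.finite_range _).bddAbove s
  have hM0 : 0 ≤ M := (Real.sqrt_nonneg _).trans (hle x.1)
  have hD0 : 0 ≤ D := Real.sqrt_nonneg _
  have hdiff : ∀ s, |∑ j, ψ s j * w j - ∑ j, ψ s j * w' j| ≤ M * D := by
    intro s
    rw [← Finset.sum_sub_distrib]
    simp only [← mul_sub]
    exact (abs_sum_mul_le_sqrt_mul_sqrt _ _ _).trans (mul_le_mul_of_nonneg_right (hle s) hD0)
  have hinf₁ := sInf_weightedSum_le_add hKne hKsub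
    (u := fun i => ∑ j, ψ (x.2.2 i) j * w j) (v := fun i => ∑ j, ψ (x.2.2 i) j * w' j)
    (C := M * D) fun i => by linarith [(abs_le.mp (hdiff (x.2.2 i))).2]
  have hinf₂ := sInf_weightedSum_le_add hKne hKsub
    (u := fun i => ∑ j, ψ (x.2.2 i) j * w' j) (v := fun i => ∑ j, ψ (x.2.2 i) j * w j)
    (C := M * D) fun i => by linarith [(abs_le.mp (hdiff (x.2.2 i))).1]
  have hs := abs_le.mp (hdiff x.1)
  set I : ℝ := sInf {y : ℝ | ∃ α ∈ K, y = ∑ i, α i * ∑ j', ψ (x.2.2 i) j' * w j'} with hI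
  set I' : ℝ := sInf {y : ℝ | ∃ α ∈ K, y = ∑ i, α i * ∑ j', ψ (x.2.2 i) j' * w' j'} with hI'
  set c : ℝ := γ * (I - I') - (∑ j, ψ x.1 j * w j - ∑ j, ψ x.1 j * w' j) with hc
  have hF : ∀ j, F w x j - F w' x j = c * ψ x.1 j := by
    intro j
    simp only [F, ← hI, ← hI', hc]
    ring
  have hcle : |c| ≤ (1 + γ) * (M * D) := by
    rw [abs_le]
    have h₁ : γ * (I - I') ≤ γ * (M * D) := mul_le_mul_of_nonneg_left (by linarith) hγ0.le
    have h₂ : γ * (I' - I) ≤ γ * (M * D) := mul_le_mul_of_nonneg_left (by linarith) hγ0.le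
    constructor <;> linarith [hs.1, hs.2]
  calc Real.sqrt (∑ j, (F w x j - F w' x j) ^ 2)
      = |c| * Real.sqrt (∑ j, ψ x.1 j ^ 2) := by
        simp only [hF, mul_pow, ← Finset.mul_sum]
        rw [Real.sqrt_mul (sq_nonneg c), Real.sqrt_sq_eq_abs]
    _ ≤ ((1 + γ) * (M * D)) * M :=
        mul_le_mul hcle (hle x.1) (Real.sqrt_nonneg _) (by positivity)
    _ = (1 + γ) * M ^ 2 * D := by ring
end

section
/- Let S be a finite set, ν a probability vector on S with ν(s) > 0 for all s, and Π: ℝ^S → ℝ^S a linear map (the ν-weighted projection onto a subspace). Let T: ℝ^S → ℝ^S and β ∈ [0,1) satisfy ‖ΠTV − ΠTV'‖_ν ≤ β‖V − V'‖_ν for all V, V' ∈ ℝ^S. Suppose V^π ∈ ℝ^S is a fixed point of T (TV^π = V^π) and V_w ∈ ℝ^S is a fixed point of ΠT (ΠT V_w = V_w). Then ‖V_w − V^π‖_ν ≤ (1/(1−β))·‖ΠV^π − V^π‖_ν. -/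
open Finset

/-- The triangle inequality for a weighted `ℓ²` norm. -/
theorem sqrt_sum_mul_add_sq_le {S : Type*} [Fintype S] {ν : S → ℝ} (hν : ∀ s, 0 ≤ ν s)
    (f g : S → ℝ) :
    Real.sqrt (∑ s, ν s * (f s + g s) ^ 2) ≤
      Real.sqrt (∑ s, ν s * f s ^ 2) + Real.sqrt (∑ s, ν s * g s ^ 2) := by
  have weighted_norm (h : S → ℝ) :
      ‖WithLp.toLp 2 fun s => Real.sqrt (ν s) * h s‖ = Real.sqrt (∑ s, ν s * h s ^ 2) := by
    simp [EuclideanSpace.norm_eq, mul_pow, Real.sq_sqrt (hν _)]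
  have triangle := norm_add_le (WithLp.toLp 2 fun s => Real.sqrt (ν s) * f s)
    (WithLp.toLp 2 fun s => Real.sqrt (ν s) * g s)
  rw [← WithLp.toLp_add, weighted_norm, weighted_norm] at triangle
  rw [← weighted_norm]
  simpa only [mul_add, Pi.add_def] using triangle

/-- Error bound for the projected fixed point: if `ΠT` is a `β`-contraction
w.r.t. `‖·‖_ν`, `TV^π = V^π`, and `ΠT V_w = V_w`, then
`‖V_w − V^π‖_ν ≤ (1/(1−β)) ‖ΠV^π − V^π‖_ν`. -/
theorem stmt19 {S : Type*} [Fintype S]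
    (ν : S → ℝ) (hν : ∀ s, 0 < ν s) (hν1 : ∑ s, ν s = 1)
    (Proj : (S → ℝ) →ₗ[ℝ] (S → ℝ))
    (T : (S → ℝ) → S → ℝ) (β : ℝ) (hβ0 : 0 ≤ β) (hβ1 : β < 1)
    (hcontr : ∀ V V' : S → ℝ,
      Real.sqrt (∑ s, ν s * (Proj (T V) s - Proj (T V') s) ^ 2) ≤
        β * Real.sqrt (∑ s, ν s * (V s - V' s) ^ 2))
    (Vπ : S → ℝ) (hfixT : T Vπ = Vπ)
    (Vw : S → ℝ) (hfixP : Proj (T Vw) = Vw) :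
    Real.sqrt (∑ s, ν s * (Vw s - Vπ s) ^ 2) ≤
      (1 / (1 - β)) * Real.sqrt (∑ s, ν s * (Proj Vπ s - Vπ s) ^ 2) := by
  have contraction := hcontr Vw Vπ
  rw [hfixP, hfixT] at contraction
  have triangle := sqrt_sum_mul_add_sq_le (fun s => (hν s).le)
    (fun s => Vw s - Proj Vπ s) (fun s => Proj Vπ s - Vπ s)
  simp only [sub_add_sub_cancel] at triangle
  rw [one_div_mul_eq_div, le_div_iff₀ (sub_pos.mpr hβ1)]
  linarith
end
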